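/- arXiv:1508.03816 — 4 statements merged into one kernel-verified Lean document; each statement's English description precedes it below -/
import Mathlib

section
/- Let f ∈ ℝ[x₀,x₁,x₂] be a squarefree cubic form, and let T ⊂ ℙ²(ℝ) be a set of points at which f vanishes and is nonsingular (i.e. for each P ∈ T with representative u, f(u) = 0 and ∇f(u) ≠ 0), with |T| = 8 or |T| = 9; if |T| = 9, assume additionally that every cubic form vanishing at all points of T is a scalar multiple of f. Let g be a sextic form sharing no irreducible factor with f, and assume that for every P ∈ T with representative u one has g(u) = 0 and ∇g(u) ∈ ℝ·∇f(u) (this expresses that the local intersection number i_P(f,g) is at least 2). Then there exists a cubic form p such that the sextic form g + p·f is singular at every point of T. -/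
open MvPolynomial

noncomputable section

/-- The real projective plane, as lines through the origin of `ℝ³`. -/
abbrev P2 := Projectivization ℝ (Fin 3 → ℝ)

/-- A polynomial is psd if it takes only nonnegative values on `ℝ³`. -/
def Psd (g : MvPolynomial (Fin 3) ℝ) : Prop := ∀ u : Fin 3 → ℝ, 0 ≤ eval u g

/-- A polynomial is sos if it is a finite sum of squares. -/
def Sos (g : MvPolynomial (Fin 3) ℝ) : Prop :=
  ∃ (n : ℕ) (h : Fin n → MvPolynomial (Fin 3) ℝ), g = ∑ i, (h i) ^ 2

/-- A form vanishes at a point of `ℙ²(ℝ)` if it vanishes at a representative vector. -/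
def VanishAt (g : MvPolynomial (Fin 3) ℝ) (P : P2) : Prop := eval P.rep g = 0

/-- A form is singular at a point of `ℙ²(ℝ)` if it and all its first partial
derivatives vanish at a representative vector. -/
def SingAt (g : MvPolynomial (Fin 3) ℝ) (P : P2) : Prop :=
  eval P.rep g = 0 ∧ ∀ i, eval P.rep (pderiv i g) = 0

/-- `I_d(T)`: the space of degree-`d` forms vanishing at every point of `T`. -/
def Isub (d : ℕ) (T : Set P2) : Submodule ℝ (MvPolynomial (Fin 3) ℝ) :=
  (homogeneousSubmodule (Fin 3) ℝ d) ⊓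
  { carrier := {f | ∀ P ∈ T, VanishAt f P}
    zero_mem' := by intro P _; simp [VanishAt]
    add_mem' := by
      intro a b ha hb P hP
      have h1 := ha P hP; have h2 := hb P hP
      unfold VanishAt at *; simp [h1, h2]
    smul_mem' := by
      intro c f hf P hP
      have h1 := hf P hP
      unfold VanishAt at *; simp [smul_eq_C_mul, h1] }

/-- `I_d(2T)`: the space of degree-`d` forms singular at every point of `T`. -/
def Isub2 (d : ℕ) (T : Set P2) : Submodule ℝ (MvPolynomial (Fin 3) ℝ) :=
  (homogeneousSubmodule (Fin 3) ℝ d) ⊓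
  { carrier := {f | ∀ P ∈ T, SingAt f P}
    zero_mem' := by intro P _; constructor <;> simp [SingAt]
    add_mem' := by
      intro a b ha hb P hP
      obtain ⟨h1, h2⟩ := ha P hP; obtain ⟨h3, h4⟩ := hb P hP
      exact ⟨by simp [h1, h3], fun i => by simp [h2 i, h4 i]⟩
    smul_mem' := by
      intro c f hf P hP
      obtain ⟨h1, h2⟩ := hf P hP
      refine ⟨by simp [smul_eq_C_mul, h1], fun i => ?_⟩
      have := h2 i
      simp [smul_eq_C_mul, this] }

/-- `I₃(T)²`: the span of products of two cubics vanishing on `T`. -/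
def IsqCubic (T : Set P2) : Submodule ℝ (MvPolynomial (Fin 3) ℝ) :=
  Submodule.span ℝ {h | ∃ f₁ ∈ Isub 3 T, ∃ f₂ ∈ Isub 3 T, h = f₁ * f₂}

/-- No 4 points of `T` on a line, no 7 on a conic. -/
def GenPos (T : Set P2) : Prop :=
  (∀ l : MvPolynomial (Fin 3) ℝ, l ≠ 0 → l.IsHomogeneous 1 →
    {P ∈ T | VanishAt l P}.encard ≤ 3) ∧
  (∀ c : MvPolynomial (Fin 3) ℝ, c ≠ 0 → c.IsHomogeneous 2 →
    {P ∈ T | VanishAt c P}.encard ≤ 6)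

/-- The real projective zero set of `g`. -/
def VR (g : MvPolynomial (Fin 3) ℝ) : Set P2 := {P | VanishAt g P}



abbrev V3 := Fin 3 → ℝ

def cr (u v : V3) : V3 :=
  ![u 1 * v 2 - u 2 * v 1, u 2 * v 0 - u 0 * v 2, u 0 * v 1 - u 1 * v 0]

def dt (u v : V3) : ℝ := u 0 * v 0 + u 1 * v 1 + u 2 * v 2

/-- linear form -/
def LF (n : V3) : MvPolynomial (Fin 3) ℝ := C (n 0) * X 0 + C (n 1) * X 1 + C (n 2) * X 2

lemma eval_LF (n x : V3) : eval x (LF n) = dt n x := by simp [LF, dt]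

lemma LF_hom (n : V3) : (LF n).IsHomogeneous 1 := by
  have h : ∀ i, (C (n i) * X i : MvPolynomial (Fin 3) ℝ).IsHomogeneous 1 := fun i => by
    simpa using (isHomogeneous_C (Fin 3) (n i)).mul (isHomogeneous_X ℝ i)
  exact ((h 0).add (h 1)).add (h 2)

def qv (q : Fin 6 → ℝ) (x : V3) : ℝ :=
  q 0 * (x 0 * x 0) + q 1 * (x 1 * x 1) + q 2 * (x 2 * x 2) + q 3 * (x 1 * x 2)
    + q 4 * (x 0 * x 2) + q 5 * (x 0 * x 1)

def QF (q : Fin 6 → ℝ) : MvPolynomial (Fin 3) ℝ :=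
  C (q 0) * (X 0 * X 0) + C (q 1) * (X 1 * X 1) + C (q 2) * (X 2 * X 2) + C (q 3) * (X 1 * X 2)
    + C (q 4) * (X 0 * X 2) + C (q 5) * (X 0 * X 1)

lemma eval_QF (q : Fin 6 → ℝ) (x : V3) : eval x (QF q) = qv q x := by simp [QF, qv]

lemma QF_hom (q : Fin 6 → ℝ) : (QF q).IsHomogeneous 2 := by
  have h : ∀ (c : ℝ) (i j : Fin 3),
      (C c * (X i * X j) : MvPolynomial (Fin 3) ℝ).IsHomogeneous 2 := fun c i j => by
    simpa using (isHomogeneous_C (Fin 3) c).mul ((isHomogeneous_X ℝ i).mul (isHomogeneous_X ℝ j))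
  exact (((((h _ _ _).add (h _ _ _)).add (h _ _ _)).add (h _ _ _)).add (h _ _ _)).add (h _ _ _)

/-- gradient of the quadratic form at `o` -/
def qg (q : Fin 6 → ℝ) (o : V3) : V3 :=
  ![2 * q 0 * o 0 + q 4 * o 2 + q 5 * o 1, 2 * q 1 * o 1 + q 3 * o 2 + q 5 * o 0,
    2 * q 2 * o 2 + q 3 * o 1 + q 4 * o 0]

/-- vanishing and tangency -/
def Good (f g : MvPolynomial (Fin 3) ℝ) (v : V3) : Prop :=
  eval v f = 0 ∧ eval v g = 0 ∧ ∃ c : ℝ, ∀ i, eval v (pderiv i g) = c * eval v (pderiv i f)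

lemma hom_eval_smul {p : MvPolynomial (Fin 3) ℝ} {d : ℕ} (hp : p.IsHomogeneous d) (k : ℝ)
    (v : V3) : eval (k • v) p = k ^ d * eval v p := by
  rw [eval_eq, eval_eq, Finset.mul_sum]
  refine Finset.sum_congr rfl fun m hm => ?_
  have hd : m.degree = d := by
    have := hp (mem_support_iff.1 hm)
    rw [Finsupp.degree_eq_weight_one]; exact this
  have : ∏ i ∈ m.support, (k • v) i ^ m i = k ^ d * ∏ i ∈ m.support, v i ^ m i := by
    simp only [Pi.smul_apply, smul_eq_mul, mul_pow, Finset.prod_mul_distrib]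
    rw [Finset.prod_pow_eq_pow_sum, ← hd]; rfl
  rw [this]; ring

lemma Good.smul {f g : MvPolynomial (Fin 3) ℝ} (hf : f.IsHomogeneous 3) (hg : g.IsHomogeneous 6)
    {v : V3} (h : Good f g v) (k : ℝ) : Good f g (k • v) := by
  obtain ⟨h1, h2, c, h3⟩ := h
  refine ⟨by rw [hom_eval_smul hf, h1, mul_zero], by rw [hom_eval_smul hg, h2, mul_zero],
    k ^ 3 * c, fun i => ?_⟩
  have a : (pderiv i f).IsHomogeneous 2 := hf.pderiv
  have b : (pderiv i g).IsHomogeneous 5 := hg.pderiv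
  rw [hom_eval_smul a, hom_eval_smul b, h3]
  ring

lemma chain (γ : Fin 3 → Polynomial ℝ) (p : MvPolynomial (Fin 3) ℝ) :
    Polynomial.derivative (aeval γ p) =
      ∑ i, aeval γ (pderiv i p) * Polynomial.derivative (γ i) := by
  induction p using MvPolynomial.induction_on with
  | C a => simp
  | add p q hp hq => simp [hp, hq, add_mul, Finset.sum_add_distrib]
  | mul_X p j hp =>
    have key : ∀ i, aeval γ (pderiv i (p * X j)) = aeval γ (pderiv i p) * γ j
        + if j = i then aeval γ p else 0 := by
      intro i
      rw [Derivation.leibniz, pderiv_X, smul_eq_mul, smul_eq_mul, map_add, map_mul, map_mul,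
        aeval_X]
      by_cases h : j = i
      · subst h; simp; ring
      · simp [h]; ring
    simp only [key, add_mul, Finset.sum_add_distrib, map_mul, aeval_X,
      Polynomial.derivative_mul, hp, Finset.sum_mul, ite_mul, zero_mul, Finset.sum_ite_eq,
      Finset.mem_univ, if_true]
    rw [add_left_inj]
    exact Finset.sum_congr rfl fun i _ => by ring

lemma eval_aeval (γ : Fin 3 → Polynomial ℝ) (p : MvPolynomial (Fin 3) ℝ) (t : ℝ) :
    (aeval γ p).eval t = eval (fun i => (γ i).eval t) p := by
  induction p using MvPolynomial.induction_on with
  | C a => simp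
  | add p q hp hq => simp [hp, hq]
  | mul_X p j hp => simp [hp]

lemma curve {f g : MvPolynomial (Fin 3) ℝ} (hf : f.IsHomogeneous 3) (hg : g.IsHomogeneous 6)
    (γ : Fin 3 → Polynomial ℝ) (e N : ℕ) (hγ : ∀ i, (γ i).natDegree ≤ e) (hN : e * 3 < N)
    (t : Fin N → ℝ) (ht : Function.Injective t)
    (hgood : ∀ j, Good f g (fun i => (γ i).eval (t j))) (s : ℝ) :
    eval (fun i => (γ i).eval s) f = 0 ∧ eval (fun i => (γ i).eval s) g = 0 := by
  have df : (aeval γ f).natDegree ≤ 3 * e := aeval_natDegree_le f hf.totalDegree_le γ hγ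
  have dg : (aeval γ g).natDegree ≤ 6 * e := aeval_natDegree_le g hg.totalDegree_le γ hγ
  have f0 : aeval γ f = 0 := by
    refine Polynomial.eq_zero_of_natDegree_lt_card_of_eval_eq_zero _ ht (fun j => ?_) ?_
    · rw [eval_aeval]; exact (hgood j).1
    · simp; omega
  have g0 : aeval γ g = 0 := by
    by_contra hne
    have hdvd : (∏ j : Fin N, (Polynomial.X - Polynomial.C (t j)) ^ 2) ∣ aeval γ g := by
      apply Finset.prod_dvd_of_coprime
      · intro i _ j _ hij
        exact (Polynomial.isCoprime_X_sub_C_of_isUnit_sub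
          ((sub_ne_zero.2 (ht.ne hij)).isUnit)).pow
      · intro j _
        have h1 : (aeval γ g).IsRoot (t j) := by
          rw [Polynomial.IsRoot, eval_aeval]; exact (hgood j).2.1
        have h2 : (Polynomial.derivative (aeval γ g)).IsRoot (t j) := by
          obtain ⟨c, hc⟩ := (hgood j).2.2
          have hd : (Polynomial.derivative (aeval γ f)).eval (t j) = 0 := by simp [f0]
          rw [chain, Polynomial.eval_finsetSum] at hd
          rw [Polynomial.IsRoot, chain, Polynomial.eval_finsetSum]
          have : ∀ i, (aeval γ (pderiv i g) * Polynomial.derivative (γ i)).eval (t j)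
              = c * (aeval γ (pderiv i f) * Polynomial.derivative (γ i)).eval (t j) := by
            intro i
            rw [Polynomial.eval_mul, Polynomial.eval_mul, eval_aeval, eval_aeval, hc i, mul_assoc]
          simp only [this]
          rw [← Finset.mul_sum, hd, mul_zero]
        have := (Polynomial.one_lt_rootMultiplicity_iff_isRoot hne).2 ⟨h1, h2⟩
        exact (Polynomial.le_rootMultiplicity_iff hne).1 this
    have := Polynomial.natDegree_le_of_dvd hdvd hne
    rw [Polynomial.natDegree_prod _ _ (fun j _ => pow_ne_zero _ (Polynomial.X_sub_C_ne_zero _))] at this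
    simp at this
    omega
  rw [← eval_aeval, ← eval_aeval, f0, g0]; simp

lemma eval_aeval' (Y : Fin 3 → MvPolynomial (Fin 3) ℝ) (p : MvPolynomial (Fin 3) ℝ) (x : V3) :
    eval x (aeval Y p) = eval (fun i => eval x (Y i)) p := by
  induction p using MvPolynomial.induction_on with
  | C a => simp
  | add p q hp hq => rw [map_add, map_add, map_add, hp, hq]
  | mul_X p j hp => rw [map_mul, map_mul, map_mul, hp, aeval_X, eval_X]

lemma aeval_smulX {p : MvPolynomial (Fin 3) ℝ} {d : ℕ} (hp : p.IsHomogeneous d)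
    (m : MvPolynomial (Fin 3) ℝ) : aeval (fun i => m * X i) p = m ^ d * p := by
  refine MvPolynomial.funext fun x => ?_
  rw [eval_aeval']
  have h := hom_eval_smul hp (eval x m) x
  rw [map_mul, map_pow, ← h]
  congr 2
  funext i
  simp

lemma dvd_step {p : MvPolynomial (Fin 3) ℝ} {d : ℕ} (hp : p.IsHomogeneous d)
    (Q m : MvPolynomial (Fin 3) ℝ) (Y : Fin 3 → MvPolynomial (Fin 3) ℝ)
    (hY : ∀ i, Q ∣ Y i - m * X i)
    (h0 : ∀ x, eval x m ≠ 0 → eval (fun i => eval x (Y i)) p = 0) :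
    Q ∣ m ^ (d + 1) * p := by
  have h1 : m * aeval Y p = 0 := by
    refine MvPolynomial.funext fun x => ?_
    rw [map_mul, eval_aeval']
    by_cases h : eval x m = 0
    · simp [h]
    · simp [h0 x h]
  have h2 : Q ∣ aeval Y p - aeval (fun i => m * X i) p := by
    rw [← Ideal.mem_span_singleton, ← Ideal.Quotient.eq]
    have hYY : ∀ i, Ideal.Quotient.mkₐ ℝ (Ideal.span {Q}) (Y i)
        = Ideal.Quotient.mkₐ ℝ (Ideal.span {Q}) (m * X i) := fun i =>
      Ideal.Quotient.eq.2 (Ideal.mem_span_singleton.2 (hY i))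
    have := MvPolynomial.comp_aeval_apply (Ideal.Quotient.mkₐ ℝ (Ideal.span {Q})) (f := Y) (p := p)
    have h' := MvPolynomial.comp_aeval_apply (Ideal.Quotient.mkₐ ℝ (Ideal.span {Q}))
      (f := fun i => m * X i) (p := p)
    simp only [hYY] at this
    exact this.trans h'.symm
  rw [aeval_smulX hp] at h2
  have h3 := h2.mul_left m
  rw [mul_sub, h1, zero_sub, dvd_neg] at h3
  rw [pow_succ', mul_assoc]
  exact h3

lemma final {f g : MvPolynomial (Fin 3) ℝ} (hf : f.IsHomogeneous 3) (hg : g.IsHomogeneous 6)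
    (hc : IsRelPrime f g)
    (Q m : MvPolynomial (Fin 3) ℝ) (Y : Fin 3 → MvPolynomial (Fin 3) ℝ)
    (hY : ∀ i, Q ∣ Y i - m * X i)
    (h0 : ∀ x, eval x m ≠ 0 → eval (fun i => eval x (Y i)) f = 0 ∧ eval (fun i => eval x (Y i)) g = 0)
    (v : V3) (hv : eval v Q = 0) (hm : eval v m ≠ 0) : False := by
  have hF := dvd_step hf Q m Y hY fun x hx => (h0 x hx).1
  have hG := dvd_step hg Q m Y hY fun x hx => (h0 x hx).2
  have hF' : Q ∣ m ^ 7 * f := hF.trans (mul_dvd_mul_right (pow_dvd_pow _ (by norm_num)) _)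
  have hQ : Q ∣ m ^ 7 := by
    let _ : GCDMonoid (MvPolynomial (Fin 3) ℝ) := UniqueFactorizationMonoid.toGCDMonoid _
    have h := dvd_gcd hF' hG
    have h2 := h.trans (gcd_mul_left' (m ^ 7) f g).dvd
    have hu : IsUnit (gcd f g) := hc (gcd_dvd_left _ _) (gcd_dvd_right _ _)
    exact (hu.dvd_mul_right).1 h2
  obtain ⟨r, hr⟩ := hQ
  have := congrArg (eval v) hr
  rw [map_mul, hv, zero_mul, map_pow] at this
  exact hm (pow_eq_zero_iff (by norm_num) |>.1 this)

lemma dt_self_ne {u : V3} (h : u ≠ 0) : dt u u ≠ 0 := by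
  intro h0
  unfold dt at h0
  apply h
  have a : u 0 = 0 := by nlinarith [mul_self_nonneg (u 0), mul_self_nonneg (u 1), mul_self_nonneg (u 2)]
  have b : u 1 = 0 := by nlinarith [mul_self_nonneg (u 0), mul_self_nonneg (u 1), mul_self_nonneg (u 2)]
  have c : u 2 = 0 := by nlinarith [mul_self_nonneg (u 0), mul_self_nonneg (u 1), mul_self_nonneg (u 2)]
  ext i; fin_cases i <;> simpa

lemma dt_smul (n : V3) (k : ℝ) (v : V3) : dt n (k • v) = k * dt n v := by
  simp [dt]; ring

lemma dt_comm (n v : V3) : dt n v = dt v n := by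
  simp [dt]; ring

lemma cr_smul_ne {u v : V3} (h : cr u v ≠ 0) {a b : ℝ} (_ha : a ≠ 0) (hb : b ≠ 0) :
    a • u ≠ b • v := by
  intro he
  apply h
  have h0 := congrFun he 0
  have h1 := congrFun he 1
  have h2 := congrFun he 2
  simp only [Pi.smul_apply, smul_eq_mul] at h0 h1 h2
  have key : ∀ x : ℝ, b * x = 0 → x = 0 := fun x hx => by simpa [hb] using hx
  ext i; fin_cases i <;> simp only [cr] <;> apply key
  · show b * (u 1 * v 2 - u 2 * v 1) = 0
    linear_combination (-u 1) * h2 + u 2 * h1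
  · show b * (u 2 * v 0 - u 0 * v 2) = 0
    linear_combination (-u 2) * h0 + u 0 * h2
  · show b * (u 0 * v 1 - u 1 * v 0) = 0
    linear_combination (-u 0) * h1 + u 1 * h0

/-- Four tangency points on a line contradict coprimality. -/
lemma no_line {f g : MvPolynomial (Fin 3) ℝ} (hf : f.IsHomogeneous 3) (hg : g.IsHomogeneous 6)
    (hc : IsRelPrime f g) (n : V3) (u : Fin 4 → V3)
    (hu : ∀ i, Good f g (u i)) (hne : ∀ i j, i ≠ j → cr (u i) (u j) ≠ 0)
    (hnz : ∀ i, u i ≠ 0) (hn : n ≠ 0) (hnu : ∀ i, dt n (u i) = 0) : False := by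
  obtain ⟨w, hw⟩ : ∃ w : V3, ∀ i, dt w (u i) ≠ 0 := by
    obtain ⟨φ, hφ⟩ := Module.exists_dual_forall_apply_ne_zero (K := ℝ) u hnz
    refine ⟨fun i => φ (fun j => if i = j then 1 else 0), fun i => ?_⟩
    have := hφ i
    rw [LinearMap.pi_apply_eq_sum_univ φ (u i), Fin.sum_univ_three] at this
    intro h
    apply this
    simp only [smul_eq_mul]
    unfold dt at h
    linear_combination h
  set B : V3 := cr n w with hB
  have hBn : B ≠ 0 := by
    intro h0
    have h1 := hnu 0
    have h2 := hw 0
    have hnn := dt_self_ne hn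
    have e0 : n 1 * w 2 - n 2 * w 1 = 0 := congrFun h0 0
    have e1 : n 2 * w 0 - n 0 * w 2 = 0 := congrFun h0 1
    have e2 : n 0 * w 1 - n 1 * w 0 = 0 := congrFun h0 2
    apply mul_ne_zero hnn h2
    unfold dt at *
    linear_combination (n 0 * w 0 + n 1 * w 1 + n 2 * w 2) * h1 
      + (n 1 * u 0 2 - n 2 * u 0 1) * e0 + (n 2 * u 0 0 - n 0 * u 0 2) * e1 
      + (n 0 * u 0 1 - n 1 * u 0 0) * e2
  have hBB := dt_self_ne hBn
  set A : V3 := (dt w (u 0))⁻¹ • u 0 with hA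
  have hAn : dt n A = 0 := by rw [hA, dt_smul, hnu, mul_zero]
  have hAw : dt w A = 1 := by rw [hA, dt_smul, inv_mul_cancel₀ (hw 0)]
  have par : ∀ v : V3, dt n v = 0 → dt w v = 1 →
      ∀ i, v i = A i + (dt B B)⁻¹ * (dt B v - dt B A) * B i := by
    intro v h1 h2 i
    have : dt B B * (v i - A i) = (dt B v - dt B A) * B i := by
      have e1 : n 0 * (v 0 - A 0) + n 1 * (v 1 - A 1) + n 2 * (v 2 - A 2) = 0 := by
        unfold dt at *; linear_combination h1 - hAn
      have e2 : w 0 * (v 0 - A 0) + w 1 * (v 1 - A 1) + w 2 * (v 2 - A 2) = 0 := by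
        unfold dt at *; linear_combination h2 - hAw
      have f0 : B 1 * (v 2 - A 2) - B 2 * (v 1 - A 1) = 0 := by
        simp only [hB, cr, Matrix.cons_val]
        linear_combination w 0 * e1 - n 0 * e2
      have f1 : B 2 * (v 0 - A 0) - B 0 * (v 2 - A 2) = 0 := by
        simp only [hB, cr, Matrix.cons_val]
        linear_combination w 1 * e1 - n 1 * e2
      have f2 : B 0 * (v 1 - A 1) - B 1 * (v 0 - A 0) = 0 := by
        simp only [hB, cr, Matrix.cons_val]
        linear_combination w 2 * e1 - n 2 * e2
      unfold dt
      fin_cases i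
      · simp only [Fin.zero_eta]
        linear_combination B 2 * f1 - B 1 * f2
      · simp only [Fin.mk_one]
        linear_combination B 0 * f2 - B 2 * f0
      · simp only [Fin.reduceFinMk]
        linear_combination B 1 * f0 - B 0 * f1
    field_simp
    linear_combination this
  let γ : Fin 3 → Polynomial ℝ := fun i => Polynomial.C (A i) + Polynomial.X * Polynomial.C (B i)
  have hγe : ∀ s, (fun i => (γ i).eval s) = fun i => A i + s * B i := by
    intro s; funext i; simp [γ]; ring
  let v : Fin 4 → V3 := fun j => (dt w (u j))⁻¹ • u j
  have hvn : ∀ j, dt n (v j) = 0 := fun j => by simp only [v]; rw [dt_smul, hnu, mul_zero]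
  have hvw : ∀ j, dt w (v j) = 1 := fun j => by
    simp only [v]; rw [dt_smul, inv_mul_cancel₀ (hw j)]
  let t : Fin 4 → ℝ := fun j => (dt B B)⁻¹ * (dt B (v j) - dt B A)
  have hvt : ∀ j, v j = fun i => A i + t j * B i := fun j => by
    funext i; exact par (v j) (hvn j) (hvw j) i
  have hcurve := curve hf hg γ 1 4 (by
      intro i
      simp only [γ]
      compute_degree) (by norm_num) t (by
      intro i j hij
      by_contra hne'
      have : v i = v j := by rw [hvt i, hvt j, hij]
      exact cr_smul_ne (hne i j hne') (inv_ne_zero (hw i)) (inv_ne_zero (hw j)) this) (by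
      intro j
      rw [hγe, ← hvt]
      exact (hu j).smul hf hg _)
  have hall : ∀ x : V3, dt n x = 0 → dt w x ≠ 0 → eval x f = 0 ∧ eval x g = 0 := by
    intro x h1 h2
    have hx := par ((dt w x)⁻¹ • x) (by rw [dt_smul, h1, mul_zero])
      (by rw [dt_smul, inv_mul_cancel₀ h2])
    have h := hcurve ((dt B B)⁻¹ * (dt B ((dt w x)⁻¹ • x) - dt B A))
    rw [hγe] at h
    rw [← funext hx, hom_eval_smul hf, hom_eval_smul hg] at h
    simpa [h2] using h
  set k : V3 := cr w B with hk
  have hwk : dt w k = 0 := by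
    simp only [hk, cr, dt, Matrix.cons_val]; ring
  have hnk : dt n k = dt B B := by
    simp only [hk, hB, cr, dt, Matrix.cons_val]; ring
  refine final hf hg hc (LF n) (C (dt B B) * LF w)
    (fun i => LF w * (C (dt B B) * X i - LF n * C (k i))) ?_ ?_ (u 0) ?_ ?_
  · intro i
    exact ⟨- LF w * C (k i), by ring⟩
  · intro x hx
    have hwx : dt w x ≠ 0 := by
      rw [map_mul, eval_LF] at hx
      exact right_ne_zero_of_mul hx
    simp only [map_mul, map_sub, eval_LF, eval_C, eval_X]
    apply hall
    · have : dt n (fun i => dt w x * (dt B B * x i - dt n x * k i))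
        = dt w x * (dt B B * dt n x - dt n x * dt n k) := by simp only [dt]; ring
      rw [this, hnk]; ring
    · have : dt w (fun i => dt w x * (dt B B * x i - dt n x * k i))
        = dt w x * (dt B B * dt w x - dt n x * dt w k) := by simp only [dt]; ring
      rw [this, hwk, mul_zero, sub_zero]
      exact mul_ne_zero hwx (mul_ne_zero hBB hwx)
  · rw [eval_LF, hnu]
  · rw [map_mul, eval_C, eval_LF]
    exact mul_ne_zero hBB (hw 0)

lemma qv_smul (q : Fin 6 → ℝ) (k : ℝ) (v : V3) : qv q (k • v) = k ^ 2 * qv q v := by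
  simp [qv]; ring

/-- Seven tangency points on a conic contradict coprimality. -/
lemma no_conic {f g : MvPolynomial (Fin 3) ℝ} (hf : f.IsHomogeneous 3) (hg : g.IsHomogeneous 6)
    (hc : IsRelPrime f g) (q : Fin 6 → ℝ) (o : V3) (ho : o ≠ 0) (hqo : qv q o = 0)
    (u : Fin 7 → V3)
    (hu : ∀ i, Good f g (u i)) (hne : ∀ i j, i ≠ j → cr (u i) (u j) ≠ 0)
    (hqu : ∀ i, qv q (u i) = 0) (hw : ∀ i, dt (qg q o) (u i) ≠ 0) : False := by
  set n : V3 := qg q o with hn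
  have hn0 : n ≠ 0 := by
    intro h; apply hw 0; rw [h]; simp [dt]
  have hno : dt n o = 0 := by
    have : dt n o = 2 * qv q o := by simp only [hn, dt, qg, qv, Matrix.cons_val]; ring
    rw [this, hqo, mul_zero]
  have hnn := dt_self_ne hn0
  have hoo := dt_self_ne ho
  set B : V3 := cr n o with hB
  have hBB' : dt B B = dt n n * dt o o := by
    have : dt B B = dt n n * dt o o - dt n o ^ 2 := by
      simp only [hB, cr, dt, Matrix.cons_val]; ring
    rw [this, hno]; ring
  have hBB : dt B B ≠ 0 := by rw [hBB']; exact mul_ne_zero hnn hoo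
  have hnB : dt n B = 0 := by simp only [hB, cr, dt, Matrix.cons_val]; ring
  let A : V3 := (dt n n)⁻¹ • n
  have hAn : dt n A = 1 := by simp only [A]; rw [dt_smul, inv_mul_cancel₀ hnn]
  -- expansion in the orthogonal basis
  have expand : ∀ v : V3, ∀ i, dt n n * dt o o * v i
      = dt n v * dt o o * n i + dt B v * B i + dt o v * dt n n * o i := by
    intro v i
    have h : n 0 * o 0 + n 1 * o 1 + n 2 * o 2 = 0 := hno
    fin_cases i
    · simp only [hB, cr, dt, Matrix.cons_val, Fin.zero_eta]
      linear_combination ((n 0 * o 0 + n 1 * o 1 + n 2 * o 2) * v 0 - (n 0 * v 0 + n 1 * v 1 + n 2 * v 2) * o 0 - (o 0 * v 0 + o 1 * v 1 + o 2 * v 2) * n 0) * h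
    · simp only [hB, cr, dt, Matrix.cons_val, Fin.mk_one]
      linear_combination ((n 0 * o 0 + n 1 * o 1 + n 2 * o 2) * v 1 - (n 0 * v 0 + n 1 * v 1 + n 2 * v 2) * o 1 - (o 0 * v 0 + o 1 * v 1 + o 2 * v 2) * n 1) * h
    · simp only [hB, cr, dt, Matrix.cons_val, Fin.reduceFinMk]
      linear_combination ((n 0 * o 0 + n 1 * o 1 + n 2 * o 2) * v 2 - (n 0 * v 0 + n 1 * v 1 + n 2 * v 2) * o 2 - (o 0 * v 0 + o 1 * v 1 + o 2 * v 2) * n 2) * h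
  have qadd : ∀ (x : V3) (k : ℝ), qv q (x + k • o) = qv q x + k * dt n x := by
    intro x k
    have : qv q (x + k • o) = qv q x + k * dt n x + k ^ 2 * qv q o := by
      simp only [hn, dt, qg, qv, Matrix.cons_val, Pi.add_apply, Pi.smul_apply, smul_eq_mul]; ring
    rw [this, hqo]; ring
  have par : ∀ v : V3, qv q v = 0 → dt n v = 1 →
      v = (A + ((dt B B)⁻¹ * dt B v) • B)
        + (- qv q (A + ((dt B B)⁻¹ * dt B v) • B)) • o := by
    intro v h1 h2
    set x : V3 := A + ((dt B B)⁻¹ * dt B v) • B with hx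
    have e : v = x + ((dt o o)⁻¹ * dt o v) • o := by
      funext i
      have := expand v i
      rw [h2] at this
      simp only [hx, A, Pi.add_apply, Pi.smul_apply, smul_eq_mul, hBB']
      field_simp
      linear_combination this
    have hnx : dt n x = 1 := by
      have : dt n x = dt n A + ((dt B B)⁻¹ * dt B v) * dt n B := by
        simp only [hx, dt, Pi.add_apply, Pi.smul_apply, smul_eq_mul]; ring
      rw [this, hAn, hnB]; ring
    have h3 := qadd x ((dt o o)⁻¹ * dt o v)
    rw [← e, h1, hnx] at h3
    have h4 : (dt o o)⁻¹ * dt o v = - qv q x := by linarith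
    rw [← h4]; exact e
  let L : Fin 3 → Polynomial ℝ := fun i => Polynomial.C (A i) + Polynomial.X * Polynomial.C (B i)
  let γ : Fin 3 → Polynomial ℝ := fun i => L i - (Polynomial.C (q 0) * (L 0 * L 0)
    + Polynomial.C (q 1) * (L 1 * L 1) + Polynomial.C (q 2) * (L 2 * L 2)
    + Polynomial.C (q 3) * (L 1 * L 2) + Polynomial.C (q 4) * (L 0 * L 2)
    + Polynomial.C (q 5) * (L 0 * L 1)) * Polynomial.C (o i)
  have hγe : ∀ s, (fun i => (γ i).eval s) = (A + s • B) + (- qv q (A + s • B)) • o := by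
    intro s; funext i; simp [γ, L, qv]; ring
  let v : Fin 7 → V3 := fun j => (dt n (u j))⁻¹ • u j
  have hvn : ∀ j, qv q (v j) = 0 := fun j => by simp only [v]; rw [qv_smul, hqu, mul_zero]
  have hvw : ∀ j, dt n (v j) = 1 := fun j => by
    simp only [v]; rw [dt_smul, inv_mul_cancel₀ (hw j)]
  let t : Fin 7 → ℝ := fun j => (dt B B)⁻¹ * dt B (v j)
  have hvt : ∀ j, v j = (A + t j • B) + (- qv q (A + t j • B)) • o := fun j =>
    par (v j) (hvn j) (hvw j)
  have hcurve := curve hf hg γ 2 7 (by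
      intro i
      simp only [γ, L]
      compute_degree) (by norm_num) t (by
      intro i j hij
      by_contra hne'
      have : v i = v j := by rw [hvt i, hvt j, hij]
      exact cr_smul_ne (hne i j hne') (inv_ne_zero (hw i)) (inv_ne_zero (hw j)) this) (by
      intro j
      rw [hγe, ← hvt]
      exact (hu j).smul hf hg _)
  have hall : ∀ x : V3, qv q x = 0 → dt n x ≠ 0 → eval x f = 0 ∧ eval x g = 0 := by
    intro x h1 h2
    have hx := par ((dt n x)⁻¹ • x) (by rw [qv_smul, h1, mul_zero])
      (by rw [dt_smul, inv_mul_cancel₀ h2])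
    have h := hcurve ((dt B B)⁻¹ * dt B ((dt n x)⁻¹ • x))
    rw [hγe, ← hx, hom_eval_smul hf, hom_eval_smul hg] at h
    simpa [h2] using h
  refine final hf hg hc (QF q) (LF n)
    (fun i => LF n * X i - QF q * C (o i)) ?_ ?_ (u 0) ?_ ?_
  · intro i
    exact ⟨- C (o i), by ring⟩
  · intro x hx
    rw [eval_LF] at hx
    simp only [map_mul, map_sub, eval_LF, eval_QF, eval_C, eval_X]
    have e : (fun i => dt n x * x i - qv q x * o i) = dt n x • x + (-qv q x) • o := by
      funext i; simp; ring
    rw [e]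
    apply hall
    · rw [qadd, qv_smul, dt_smul]; ring
    · have : dt n (dt n x • x + (-qv q x) • o) = dt n x * dt n x - qv q x * dt n o := by
        simp [dt]; ring
      rw [this, hno, mul_zero, sub_zero]
      exact mul_ne_zero hx hx
  · rw [eval_QF, hqu]
  · rw [eval_LF]; exact hw 0

def det3 (a b c : V3) : ℝ := dt (cr a b) c

lemma cramer (a b c x : V3) (i : Fin 3) :
    det3 a b c * x i = det3 b c x * a i + det3 c a x * b i + det3 a b x * c i := by
  fin_cases i <;> simp [det3, dt, cr] <;> ring

lemma eq_zero_of_det {a b c n : V3} (h : det3 a b c ≠ 0) (ha : dt n a = 0) (hb : dt n b = 0)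
    (hc : dt n c = 0) : n = 0 := by
  have key : ∀ x : ℝ, det3 a b c * x = 0 → x = 0 := fun x hx => by simpa [h] using hx
  ext i
  apply key
  fin_cases i
  · simp only [det3, cr, dt, Matrix.cons_val, Fin.zero_eta] at *
    linear_combination (b 1 * c 2 - b 2 * c 1) * ha + (c 1 * a 2 - c 2 * a 1) * hb
      + (a 1 * b 2 - a 2 * b 1) * hc
  · simp only [det3, cr, dt, Matrix.cons_val, Fin.mk_one] at *
    linear_combination (b 2 * c 0 - b 0 * c 2) * ha + (c 2 * a 0 - c 0 * a 2) * hb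
      + (a 2 * b 0 - a 0 * b 2) * hc
  · simp only [det3, cr, dt, Matrix.cons_val, Fin.reduceFinMk] at *
    linear_combination (b 0 * c 1 - b 1 * c 0) * ha + (c 0 * a 1 - c 1 * a 0) * hb
      + (a 0 * b 1 - a 1 * b 0) * hc

lemma qv_comb (q : Fin 6 → ℝ) (a b c : V3) (r s t : ℝ) :
    qv q (r • a + s • b + t • c) = r ^ 2 * qv q a + s ^ 2 * qv q b + t ^ 2 * qv q c
      + r * s * dt (qg q a) b + r * t * dt (qg q c) a + s * t * dt (qg q c) b := by
  simp only [qv, dt, qg, Matrix.cons_val, Pi.add_apply, Pi.smul_apply, smul_eq_mul]; ring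

lemma cramer' {a b c : V3} (h : det3 a b c ≠ 0) (x : V3) :
    ∃ r s t : ℝ, x = r • a + s • b + t • c ∧ t = (det3 a b c)⁻¹ * det3 a b x := by
  refine ⟨(det3 a b c)⁻¹ * det3 b c x, (det3 a b c)⁻¹ * det3 c a x,
    (det3 a b c)⁻¹ * det3 a b x, ?_, rfl⟩
  funext i
  have := cramer a b c x i
  simp only [Pi.add_apply, Pi.smul_apply, smul_eq_mul]
  field_simp
  linear_combination this

lemma qv_zero_imp (q : Fin 6 → ℝ) (h : ∀ x, qv q x = 0) : q = 0 := by
  have h0 := h ![1, 0, 0]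
  have h1 := h ![0, 1, 0]
  have h2 := h ![0, 0, 1]
  have h3 := h ![0, 1, 1]
  have h4 := h ![1, 0, 1]
  have h5 := h ![1, 1, 0]
  simp [qv] at h0 h1 h2 h3 h4 h5
  ext i; fin_cases i <;> simp <;> linarith

lemma nondeg (q : Fin 6 → ℝ) (a b c d e : V3) (ha : qv q a = 0) (hb : qv q b = 0)
    (hc : qv q c = 0) (hd : qv q d = 0) (he : qv q e = 0)
    (h1 : det3 a b c ≠ 0) (h2 : det3 a b d ≠ 0) (h3 : det3 a b e ≠ 0) (h4 : det3 c d e ≠ 0)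
    (hq : q ≠ 0) : dt (qg q a) b ≠ 0 := by
  intro hab
  apply hq
  have hcc : dt (qg q c) c = 0 := by
    have : dt (qg q c) c = 2 * qv q c := by simp only [dt, qg, qv, Matrix.cons_val]; ring
    rw [this, hc, mul_zero]
  have key : ∀ x, qv q x = 0 → det3 a b x ≠ 0 → dt (qg q c) x = 0 := by
    intro x hx hdet
    obtain ⟨r, s, t, hx', ht⟩ := cramer' h1 x
    have ht0 : t ≠ 0 := by rw [ht]; exact mul_ne_zero (inv_ne_zero h1) hdet
    have h := qv_comb q a b c r s t
    rw [← hx', hx, ha, hb, hc, hab] at h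
    have h' : dt (qg q c) x = r * dt (qg q c) a + s * dt (qg q c) b + t * dt (qg q c) c := by
      rw [hx']; simp only [dt, Pi.add_apply, Pi.smul_apply, smul_eq_mul]; ring
    rw [h', hcc]
    apply mul_left_cancel₀ ht0
    linear_combination -h
  have hn := eq_zero_of_det h4 hcc (key d hd h2) (key e he h3)
  apply qv_zero_imp
  intro x
  obtain ⟨r, s, t, hx', ht⟩ := cramer' h1 x
  rw [hx', qv_comb, ha, hb, hc, hab, hn]
  simp [dt]

lemma exists_sep {u v : V3} (h : cr u v ≠ 0) : ∃ n, dt n v = 0 ∧ dt n u ≠ 0 := by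
  refine ⟨fun i => dt v v * u i - dt u v * v i, ?_, ?_⟩
  · simp only [dt]; ring
  · have : dt (fun i => dt v v * u i - dt u v * v i) u = dt (cr u v) (cr u v) := by
      simp only [dt, cr, Matrix.cons_val]; ring
    rw [this]; exact dt_self_ne h

lemma dt_cr_left (u v : V3) : dt (cr u v) u = 0 := by simp only [dt, cr, Matrix.cons_val]; ring
lemma dt_cr_right (u v : V3) : dt (cr u v) v = 0 := by simp only [dt, cr, Matrix.cons_val]; ring

lemma det3_rot (a b c : V3) : det3 a b c = det3 b c a := by
  simp only [det3, dt, cr, Matrix.cons_val]; ring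

lemma exists_conic (u : Fin 5 → V3) : ∃ q : Fin 6 → ℝ, q ≠ 0 ∧ ∀ i, qv q (u i) = 0 := by
  let F : (Fin 6 → ℝ) →ₗ[ℝ] (Fin 5 → ℝ) :=
    { toFun := fun q i => qv q (u i)
      map_add' := by intro a b; funext i; simp [qv]; ring
      map_smul' := by intro a b; funext i; simp [qv]; ring }
  have h : LinearMap.ker F ≠ ⊥ := LinearMap.ker_ne_bot_of_finrank_lt (by simp)
  obtain ⟨q, hq, hq0⟩ := Submodule.exists_mem_ne_zero_of_ne_bot h
  exact ⟨q, hq0, fun i => congrFun (LinearMap.mem_ker.1 hq) i⟩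

/-- Two lines covering four points and avoiding a fifth. -/
lemma two_lines (P a b c d : V3)
    (h4 : ∀ x y z, ((x = a ∧ y = b ∧ z = c) ∨ (x = b ∧ y = a ∧ z = d) ∨ (x = c ∧ y = d ∧ z = a)
       ∨ (x = d ∧ y = c ∧ z = b)) → dt (cr P x) y = 0 → dt (cr P x) z = 0 → False) :
    ∃ n m : V3, dt n P ≠ 0 ∧ dt m P ≠ 0 ∧ dt n a * dt m a = 0 ∧ dt n b * dt m b = 0 ∧
      dt n c * dt m c = 0 ∧ dt n d * dt m d = 0 := by
  have sw : ∀ x y, dt (cr x y) P = 0 → dt (cr P y) x = 0 := fun x y h => by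
    simp only [dt, cr, Matrix.cons_val] at *; linear_combination -h
  have sw' : ∀ x y, dt (cr x y) P = 0 → dt (cr P x) y = 0 := fun x y h => by
    simp only [dt, cr, Matrix.cons_val] at *; linear_combination h
  by_cases h1 : dt (cr a b) P = 0
  · refine ⟨cr a c, cr b d, fun h => ?_, fun h => ?_, by simp [dt_cr_left], by simp [dt_cr_left],
      by simp [dt_cr_right], by simp [dt_cr_right]⟩
    · exact h4 a b c (by simp) (sw' _ _ h1) (sw' _ _ h)
    · exact h4 b a d (by simp) (sw _ _ h1) (sw' _ _ h)
  by_cases h2 : dt (cr c d) P = 0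
  · refine ⟨cr a c, cr b d, fun h => ?_, fun h => ?_, by simp [dt_cr_left], by simp [dt_cr_left],
      by simp [dt_cr_right], by simp [dt_cr_right]⟩
    · exact h4 c d a (by simp) (sw' _ _ h2) (sw _ _ h)
    · exact h4 d c b (by simp) (sw _ _ h2) (sw _ _ h)
  · exact ⟨cr a b, cr c d, h1, h2, by simp [dt_cr_left], by simp [dt_cr_right],
      by simp [dt_cr_left], by simp [dt_cr_right]⟩

/-- A relation among evaluations of cubics kills the coefficient at an isolated point. -/
lemma isolate {u : Fin 8 → V3} {c : Fin 8 → ℝ}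
    (hc : ∀ h : MvPolynomial (Fin 3) ℝ, h.IsHomogeneous 3 → ∑ i, c i * eval (u i) h = 0)
    (P : Fin 8) (n m l : V3) (hn : dt n (u P) ≠ 0) (hm : dt m (u P) ≠ 0) (hl : dt l (u P) ≠ 0)
    (h0 : ∀ j, j ≠ P → c j * (dt n (u j) * dt m (u j) * dt l (u j)) = 0) : c P = 0 := by
  have h := hc (LF n * LF m * LF l) (((LF_hom n).mul (LF_hom m)).mul (LF_hom l))
  simp only [map_mul, eval_LF] at h
  rw [Finset.sum_eq_single P (fun j _ hj => h0 j hj) (by simp)] at h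
  simpa [hn, hm, hl] using h

lemma isolate_conic {u : Fin 8 → V3} {c : Fin 8 → ℝ}
    (hc : ∀ h : MvPolynomial (Fin 3) ℝ, h.IsHomogeneous 3 → ∑ i, c i * eval (u i) h = 0)
    (P : Fin 8) (q : Fin 6 → ℝ) (l : V3) (hcP : c P ≠ 0) (hl : dt l (u P) ≠ 0)
    (h0 : ∀ j, j ≠ P → qv q (u j) * dt l (u j) = 0) : qv q (u P) = 0 := by
  have h := hc (QF q * LF l) ((QF_hom q).mul (LF_hom l))
  simp only [map_mul, eval_LF, eval_QF] at h
  rw [Finset.sum_eq_single P (fun j _ hj => by rw [h0 j hj, mul_zero]) (by simp)] at h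
  simpa [hcP, hl] using h

lemma exists_perm {k : ℕ} (x y : Fin k → Fin 8) (hx : Function.Injective x)
    (hy : Function.Injective y) : ∃ σ : Equiv.Perm (Fin 8), ∀ i, σ (x i) = y i := by
  have := Equiv.Perm.isMultiplyPretransitive (Fin 8) k
  obtain ⟨σ, hσ⟩ := MulAction.exists_smul_eq (Equiv.Perm (Fin 8))
    (⟨x, hx⟩ : Fin k ↪ Fin 8) (⟨y, hy⟩ : Fin k ↪ Fin 8)
  exact ⟨σ, fun i => congrArg (fun e : Fin k ↪ Fin 8 => e i) hσ⟩

section indep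

variable {u : Fin 8 → V3} {c : Fin 8 → ℝ}

lemma collinear_case (hne : ∀ i j, i ≠ j → cr (u i) (u j) ≠ 0)
    (hc : ∀ h : MvPolynomial (Fin 3) ℝ, h.IsHomogeneous 3 → ∑ i, c i * eval (u i) h = 0)
    (h4 : ∀ x : Fin 4 → Fin 8, Function.Injective x →
      dt (cr (u (x 0)) (u (x 1))) (u (x 2)) = 0 → dt (cr (u (x 0)) (u (x 1))) (u (x 3)) ≠ 0)
    (h012 : det3 (u 0) (u 1) (u 2) = 0) : ∀ i, c i = 0 := by
  have hn0 := dt_cr_left (u 0) (u 1)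
  have hn1 := dt_cr_right (u 0) (u 1)
  have hn2 : dt (cr (u 0) (u 1)) (u 2) = 0 := h012
  have key : ∀ P a b d e : Fin 8, Function.Injective ![0, 1, 2, P] →
      Function.Injective ![P, a, b, d] → Function.Injective ![P, b, a, e] →
      Function.Injective ![P, d, e, a] → Function.Injective ![P, e, d, b] →
      (∀ j, j ≠ P → j = 0 ∨ j = 1 ∨ j = 2 ∨ j = a ∨ j = b ∨ j = d ∨ j = e) → c P = 0 := by
    intro P a b d e i0 i1 i2 i3 i4 hcov
    obtain ⟨n, m, hn, hm, ea, eb, ed, ee⟩ := two_lines (u P) (u a) (u b) (u d) (u e) (by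
      rintro x y z (⟨rfl, rfl, rfl⟩ | ⟨rfl, rfl, rfl⟩ | ⟨rfl, rfl, rfl⟩ | ⟨rfl, rfl, rfl⟩) hy hz
      · exact h4 _ i1 hy hz
      · exact h4 _ i2 hy hz
      · exact h4 _ i3 hy hz
      · exact h4 _ i4 hy hz)
    refine isolate hc P n m (cr (u 0) (u 1)) hn hm (h4 _ i0 hn2) fun j hj => ?_
    rcases hcov j hj with rfl | rfl | rfl | rfl | rfl | rfl | rfl
    · rw [hn0]; ring
    · rw [hn1]; ring
    · rw [hn2]; ring
    · rw [ea]; ring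
    · rw [eb]; ring
    · rw [ed]; ring
    · rw [ee]; ring
  have c3 := key 3 4 5 6 7 (by decide) (by decide) (by decide) (by decide) (by decide) (by decide)
  have c4 := key 4 3 5 6 7 (by decide) (by decide) (by decide) (by decide) (by decide) (by decide)
  have c5 := key 5 3 4 6 7 (by decide) (by decide) (by decide) (by decide) (by decide) (by decide)
  have c6 := key 6 3 4 5 7 (by decide) (by decide) (by decide) (by decide) (by decide) (by decide)
  have c7 := key 7 3 4 5 6 (by decide) (by decide) (by decide) (by decide) (by decide) (by decide)
  have key2 : ∀ P a b : Fin 8, P ≠ a → P ≠ b →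
      (∀ j, j ≠ P → j = a ∨ j = b ∨ j = 3 ∨ j = 4 ∨ j = 5 ∨ j = 6 ∨ j = 7) → c P = 0 := by
    intro P a b ha hb hcov
    obtain ⟨n, hn, hn'⟩ := exists_sep (hne P a ha)
    obtain ⟨m, hm, hm'⟩ := exists_sep (hne P b hb)
    refine isolate hc P n m m hn' hm' hm' fun j hj => ?_
    rcases hcov j hj with rfl | rfl | rfl | rfl | rfl | rfl | rfl
    · rw [hn]; ring
    · rw [hm]; ring
    · rw [c3]; ring
    · rw [c4]; ring
    · rw [c5]; ring
    · rw [c6]; ring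
    · rw [c7]; ring
  have c0 := key2 0 1 2 (by decide) (by decide) (by decide)
  have c1 := key2 1 0 2 (by decide) (by decide) (by decide)
  have c2 := key2 2 0 1 (by decide) (by decide) (by decide)
  intro i
  fin_cases i <;> assumption

lemma seven_case
    (hc : ∀ h : MvPolynomial (Fin 3) ℝ, h.IsHomogeneous 3 → ∑ i, c i * eval (u i) h = 0)
    (h3 : ∀ x : Fin 3 → Fin 8, Function.Injective x →
      det3 (u (x 0)) (u (x 1)) (u (x 2)) ≠ 0)
    (h0 : c 0 = 0) : c 1 = 0 := by
  refine isolate hc 1 (cr (u 2) (u 3)) (cr (u 4) (u 5)) (cr (u 6) (u 7))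
    (h3 ![2, 3, 1] (by decide)) (h3 ![4, 5, 1] (by decide)) (h3 ![6, 7, 1] (by decide)) ?_
  intro j hj
  have : j = 0 ∨ j = 2 ∨ j = 3 ∨ j = 4 ∨ j = 5 ∨ j = 6 ∨ j = 7 := by revert j; decide
  rcases this with rfl | rfl | rfl | rfl | rfl | rfl | rfl
  · rw [h0]; ring
  · rw [dt_cr_left]; ring
  · rw [dt_cr_right]; ring
  · rw [dt_cr_left (u 4)]; ring
  · rw [dt_cr_right _ (u 5)]; ring
  · rw [dt_cr_left (u 6)]; ring
  · rw [dt_cr_right _ (u 7)]; ring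

lemma conic_case
    (hc : ∀ h : MvPolynomial (Fin 3) ℝ, h.IsHomogeneous 3 → ∑ i, c i * eval (u i) h = 0)
    (h3 : ∀ x : Fin 3 → Fin 8, Function.Injective x →
      det3 (u (x 0)) (u (x 1)) (u (x 2)) ≠ 0)
    (h0 : ∀ i, c i ≠ 0) : ∃ q : Fin 6 → ℝ, q ≠ 0 ∧ ∀ i, qv q (u i) = 0 := by
  obtain ⟨q, hq, hq5⟩ := exists_conic ![u 0, u 1, u 2, u 3, u 4]
  have q0 : qv q (u 0) = 0 := hq5 0
  have q1 : qv q (u 1) = 0 := hq5 1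
  have q2 : qv q (u 2) = 0 := hq5 2
  have q3 : qv q (u 3) = 0 := hq5 3
  have q4 : qv q (u 4) = 0 := hq5 4
  have key : ∀ P a b : Fin 8, Function.Injective ![a, b, P] →
      (∀ j, j ≠ P → j = 0 ∨ j = 1 ∨ j = 2 ∨ j = 3 ∨ j = 4 ∨ j = a ∨ j = b) →
      qv q (u P) = 0 := by
    intro P a b hi hcov
    refine isolate_conic hc P q (cr (u a) (u b)) (h0 P) (h3 _ hi) fun j hj => ?_
    rcases hcov j hj with rfl | rfl | rfl | rfl | rfl | rfl | rfl
    · rw [q0, zero_mul]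
    · rw [q1, zero_mul]
    · rw [q2, zero_mul]
    · rw [q3, zero_mul]
    · rw [q4, zero_mul]
    · rw [dt_cr_left, mul_zero]
    · rw [dt_cr_right, mul_zero]
  have q5 := key 5 6 7 (by decide) (by decide)
  have q6 := key 6 5 7 (by decide) (by decide)
  have q7 := key 7 5 6 (by decide) (by decide)
  refine ⟨q, hq, fun i => ?_⟩
  fin_cases i <;> assumption

end indep

lemma indep8 {f g : MvPolynomial (Fin 3) ℝ} (hf : f.IsHomogeneous 3) (hg : g.IsHomogeneous 6)
    (hr : IsRelPrime f g) {u : Fin 8 → V3} {c : Fin 8 → ℝ} (hnz : ∀ i, u i ≠ 0)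
    (hne : ∀ i j, i ≠ j → cr (u i) (u j) ≠ 0) (hu : ∀ i, Good f g (u i))
    (hc : ∀ h : MvPolynomial (Fin 3) ℝ, h.IsHomogeneous 3 → ∑ i, c i * eval (u i) h = 0) :
    ∀ i, c i = 0 := by
  have h4 : ∀ x : Fin 4 → Fin 8, Function.Injective x →
      dt (cr (u (x 0)) (u (x 1))) (u (x 2)) = 0 →
      dt (cr (u (x 0)) (u (x 1))) (u (x 3)) ≠ 0 := by
    intro x hx h2 h3
    refine no_line hf hg hr (cr (u (x 0)) (u (x 1))) (fun i => u (x i)) (fun i => hu _)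
      (fun i j hij => hne _ _ (hx.ne hij)) (fun i => hnz _) (hne _ _ (hx.ne (by decide))) ?_
    intro i
    fin_cases i
    · exact dt_cr_left _ _
    · exact dt_cr_right _ _
    · exact h2
    · exact h3
  have hcσ : ∀ σ : Equiv.Perm (Fin 8), ∀ h : MvPolynomial (Fin 3) ℝ, h.IsHomogeneous 3 →
      ∑ i, c (σ i) * eval (u (σ i)) h = 0 := fun σ h hh => by
    rw [Equiv.sum_comp σ (fun i => c i * eval (u i) h)]
    exact hc h hh
  by_cases h3 : ∃ x : Fin 3 → Fin 8, Function.Injective x ∧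
      det3 (u (x 0)) (u (x 1)) (u (x 2)) = 0
  · obtain ⟨x, hx, h0⟩ := h3
    obtain ⟨σ, hσ⟩ := exists_perm ![0, 1, 2] x (by decide) hx
    have s0 : σ 0 = x 0 := hσ 0
    have s1 : σ 1 = x 1 := hσ 1
    have s2 : σ 2 = x 2 := hσ 2
    have := collinear_case (u := fun i => u (σ i)) (c := fun i => c (σ i))
      (fun i j hij => hne _ _ (σ.injective.ne hij)) (hcσ σ)
      (fun y hy => h4 (fun i => σ (y i)) (σ.injective.comp hy)) (by rw [s0, s1, s2]; exact h0)
    intro i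
    simpa using this (σ.symm i)
  push Not at h3
  by_cases h0 : ∃ r, c r = 0
  · obtain ⟨r, hr0⟩ := h0
    intro P
    by_cases hP : P = r
    · rw [hP]; exact hr0
    have hinj : Function.Injective ![r, P] := by
      intro i j hij
      fin_cases i <;> fin_cases j <;> simp_all
    obtain ⟨σ, hσ⟩ := exists_perm ![0, 1] ![r, P] (by decide) hinj
    have s0 : σ 0 = r := hσ 0
    have s1 : σ 1 = P := hσ 1
    have := seven_case (u := fun i => u (σ i)) (c := fun i => c (σ i)) (hcσ σ)
      (fun y hy => h3 (fun i => σ (y i)) (σ.injective.comp hy)) (by rw [s0]; exact hr0)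
    rw [← s1]; exact this
  push Not at h0
  exfalso
  obtain ⟨q, hq, hqu⟩ := conic_case hc h3 h0
  have key : ∀ b d e k : Fin 8, Function.Injective ![0, b, d] → Function.Injective ![0, b, e] →
      Function.Injective ![0, b, k] → Function.Injective ![d, e, k] →
      dt (qg q (u 0)) (u b) ≠ 0 := fun b d e k i1 i2 i3 i4 =>
    nondeg q (u 0) (u b) (u d) (u e) (u k) (hqu _) (hqu _) (hqu _) (hqu _) (hqu _)
      (h3 _ i1) (h3 _ i2) (h3 _ i3) (h3 _ i4) hq
  refine no_conic hf hg hr q (u 0) (hnz 0) (hqu 0) (fun i => u i.succ) (fun i => hu _)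
    (fun i j hij => hne _ _ (by simpa using hij)) (fun i => hqu _) ?_
  intro i
  fin_cases i
  · exact key 1 2 3 4 (by decide) (by decide) (by decide) (by decide)
  · exact key 2 1 3 4 (by decide) (by decide) (by decide) (by decide)
  · exact key 3 1 2 4 (by decide) (by decide) (by decide) (by decide)
  · exact key 4 1 2 3 (by decide) (by decide) (by decide) (by decide)
  · exact key 5 1 2 3 (by decide) (by decide) (by decide) (by decide)
  · exact key 6 1 2 3 (by decide) (by decide) (by decide) (by decide)
  · exact key 7 1 2 3 (by decide) (by decide) (by decide) (by decide)

/-- evaluation of cubics at finitely many points -/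
def evC (N : ℕ) (u : Fin N → V3) : homogeneousSubmodule (Fin 3) ℝ 3 →ₗ[ℝ] (Fin N → ℝ) where
  toFun p i := eval (u i) p.1
  map_add' := by intro a b; funext i; simp
  map_smul' := by intro a b; funext i; simp [smul_eval]

lemma surj8 {f g : MvPolynomial (Fin 3) ℝ} (hf : f.IsHomogeneous 3) (hg : g.IsHomogeneous 6)
    (hr : IsRelPrime f g) {u : Fin 8 → V3} (hnz : ∀ i, u i ≠ 0)
    (hne : ∀ i j, i ≠ j → cr (u i) (u j) ≠ 0) (hu : ∀ i, Good f g (u i)) :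
    LinearMap.range (evC 8 u) = ⊤ := by
  by_contra h
  obtain ⟨φ, hφ0, hφ⟩ := Submodule.exists_le_ker_of_lt_top _ (lt_top_iff_ne_top.2 h)
  apply hφ0
  have h0 := indep8 hf hg hr (c := fun i => φ (fun j => if i = j then 1 else 0)) hnz hne hu (by
    intro p hp
    have : φ (evC 8 u ⟨p, hp⟩) = 0 := hφ ⟨_, rfl⟩
    rw [LinearMap.pi_apply_eq_sum_univ φ] at this
    refine Eq.trans ?_ this
    refine Finset.sum_congr rfl fun i _ => ?_
    rw [smul_eq_mul, mul_comm]; rfl)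
  ext x
  rw [LinearMap.comp_apply, LinearMap.pi_apply_eq_sum_univ φ]
  simp [h0]

def cubicMap : (Fin 10 → ℝ) →ₗ[ℝ] homogeneousSubmodule (Fin 3) ℝ 3 :=
  let M (i j k : Fin 3) : homogeneousSubmodule (Fin 3) ℝ 3 :=
    ⟨X i * X j * X k, by
      simpa using ((isHomogeneous_X ℝ i).mul (isHomogeneous_X ℝ j)).mul (isHomogeneous_X ℝ k)⟩
  Fintype.linearCombination ℝ ![M 0 0 0, M 1 1 1, M 2 2 2, M 0 0 1, M 0 0 2, M 0 1 1, M 1 1 2,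
    M 0 2 2, M 1 2 2, M 0 1 2]

lemma cubicMap_eval (c : Fin 10 → ℝ) (x : V3) : eval x (cubicMap c).1 =
    c 0 * x 0 ^ 3 + c 1 * x 1 ^ 3 + c 2 * x 2 ^ 3 + c 3 * x 0 ^ 2 * x 1 + c 4 * x 0 ^ 2 * x 2
    + c 5 * x 0 * x 1 ^ 2 + c 6 * x 1 ^ 2 * x 2 + c 7 * x 0 * x 2 ^ 2 + c 8 * x 1 * x 2 ^ 2
    + c 9 * x 0 * x 1 * x 2 := by
  simp [cubicMap, Fintype.linearCombination_apply, Fin.sum_univ_succ, smul_eval]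
  ring

lemma cubicMap_inj : Function.Injective cubicMap := by
  rw [← LinearMap.ker_eq_bot, LinearMap.ker_eq_bot']
  intro c hc
  have h : ∀ x : V3, eval x (cubicMap c).1 = 0 := fun x => by rw [hc]; simp
  simp only [cubicMap_eval] at h
  have h0 := h ![1, 0, 0]
  have h1 := h ![0, 1, 0]
  have h2 := h ![0, 0, 1]
  have h3 := h ![1, 1, 0]
  have h4 := h ![1, -1, 0]
  have h5 := h ![1, 0, 1]
  have h6 := h ![1, 0, -1]
  have h7 := h ![0, 1, 1]
  have h8 := h ![0, 1, -1]
  have h9 := h ![1, 1, 1]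
  simp at h0 h1 h2 h3 h4 h5 h6 h7 h8 h9
  ext i; fin_cases i <;> simp <;> linarith

lemma surj9 {f : MvPolynomial (Fin 3) ℝ} {u : Fin 9 → V3}
    (h9 : ∀ h : MvPolynomial (Fin 3) ℝ, h.IsHomogeneous 3 →
      (∀ i, eval (u i) h = 0) → ∃ c : ℝ, h = c • f) :
    LinearMap.range (evC 9 u) = ⊤ := by
  have h1 := LinearMap.finrank_range_add_finrank_ker ((evC 9 u).comp cubicMap)
  have h2 : Module.finrank ℝ (LinearMap.ker ((evC 9 u).comp cubicMap)) ≤ 1 := by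
    let G : LinearMap.ker ((evC 9 u).comp cubicMap) →ₗ[ℝ] Submodule.span ℝ {f} :=
      LinearMap.codRestrict _ ((Submodule.subtype _).comp
        (cubicMap.comp (Submodule.subtype _))) (by
          intro c
          obtain ⟨k, hk⟩ := h9 (cubicMap c.1).1 (cubicMap c.1).2
            (fun i => congrFun (LinearMap.mem_ker.1 c.2) i)
          refine Submodule.mem_span_singleton.2 ⟨k, hk.symm⟩)
    have hG : Function.Injective G := by
      intro a b hab
      have := congrArg Subtype.val hab
      exact Subtype.ext (cubicMap_inj (Subtype.ext this))
    exact (LinearMap.finrank_le_finrank_of_injective hG).trans (by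
      simpa using finrank_span_le_card (R := ℝ) ({f} : Set (MvPolynomial (Fin 3) ℝ)))
  rw [Module.finrank_fin_fun] at h1
  have h3 : LinearMap.range ((evC 9 u).comp cubicMap) = ⊤ := by
    apply Submodule.eq_top_of_finrank_eq
    have := Submodule.finrank_le (LinearMap.range ((evC 9 u).comp cubicMap))
    rw [Module.finrank_fin_fun] at this ⊢
    omega
  rw [eq_top_iff, ← h3]
  exact LinearMap.range_comp_le_range _ _

lemma rep_cr {P Q : P2} (h : P ≠ Q) : cr P.rep Q.rep ≠ 0 := by
  intro h0
  apply h
  have hq := dt_self_ne Q.rep_nonzero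
  rw [← P.mk_rep, ← Q.mk_rep, Projectivization.mk_eq_mk_iff']
  refine ⟨(dt Q.rep Q.rep)⁻¹ * dt P.rep Q.rep, ?_⟩
  have e0 : P.rep 1 * Q.rep 2 - P.rep 2 * Q.rep 1 = 0 := congrFun h0 0
  have e1 : P.rep 2 * Q.rep 0 - P.rep 0 * Q.rep 2 = 0 := congrFun h0 1
  have e2 : P.rep 0 * Q.rep 1 - P.rep 1 * Q.rep 0 = 0 := congrFun h0 2
  funext i
  simp only [Pi.smul_apply, smul_eq_mul]
  rw [mul_assoc, inv_mul_eq_iff_eq_mul₀ hq]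
  simp only [dt]
  fin_cases i
  · simp only [Fin.zero_eta]
    linear_combination Q.rep 2 * e1 - Q.rep 1 * e2
  · simp only [Fin.mk_one]
    linear_combination Q.rep 0 * e2 - Q.rep 2 * e0
  · simp only [Fin.reduceFinMk]
    linear_combination Q.rep 1 * e0 - Q.rep 0 * e1

lemma enum {T : Set P2} {N : ℕ} (h : T.encard = N) : Nonempty (T ≃ Fin N) := by
  have hfin : T.Finite := Set.finite_of_encard_eq_coe h
  have : Finite T := hfin
  have hc : Nat.card T = N := by
    rw [Nat.card_coe_set_eq, Set.ncard, h]; rfl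
  exact ⟨Finite.equivFinOfCardEq hc⟩

/-- Interpolation finishes the proof. -/
lemma finish {f g : MvPolynomial (Fin 3) ℝ} {T : Set P2} {N : ℕ} (e : T ≃ Fin N)
    (hu : ∀ P ∈ T, Good f g P.rep)
    (hs : LinearMap.range (evC N (fun i => (e.symm i).1.rep)) = ⊤) :
    ∃ p : MvPolynomial (Fin 3) ℝ, p.IsHomogeneous 3 ∧ ∀ P ∈ T, SingAt (g + p * f) P := by
  have hG : ∀ i, ∃ c : ℝ, ∀ j, eval (e.symm i).1.rep (pderiv j g)
      = c * eval (e.symm i).1.rep (pderiv j f) := fun i => (hu _ (e.symm i).2).2.2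
  choose c hc using hG
  obtain ⟨p, hp⟩ := LinearMap.range_eq_top.1 hs (fun i => - c i)
  refine ⟨p.1, p.2, fun P hP => ?_⟩
  obtain ⟨hf0, hg0, -⟩ := hu P hP
  have hpe : eval P.rep p.1 = - c (e ⟨P, hP⟩) := by
    have := congrFun hp (e ⟨P, hP⟩)
    simpa [evC] using this
  have hce := hc (e ⟨P, hP⟩)
  simp only [Equiv.symm_apply_apply] at hce
  refine ⟨by rw [map_add, map_mul, hf0, hg0]; ring, fun i => ?_⟩
  rw [map_add, Derivation.leibniz, map_add, map_add, smul_eq_mul, smul_eq_mul, map_mul, map_mul,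
    hf0, hpe, hce i]
  ring

theorem statement14 (f : MvPolynomial (Fin 3) ℝ) (hf3 : f.IsHomogeneous 3)
    (hsqf : Squarefree f) (T : Set P2) (hTcard : T.encard = 8 ∨ T.encard = 9)
    (hvan : ∀ P ∈ T, VanishAt f P)
    (hns : ∀ P ∈ T, ∃ i, eval P.rep (pderiv i f) ≠ 0)
    (h9 : T.encard = 9 → ∀ h : MvPolynomial (Fin 3) ℝ, h.IsHomogeneous 3 →
      (∀ P ∈ T, VanishAt h P) → ∃ c : ℝ, h = c • f)
    (g : MvPolynomial (Fin 3) ℝ) (hg6 : g.IsHomogeneous 6)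
    (hcop : ∀ π : MvPolynomial (Fin 3) ℝ, Irreducible π → π ∣ f → ¬ π ∣ g)
    (htang : ∀ P ∈ T, VanishAt g P ∧
      ∃ c : ℝ, ∀ i, eval P.rep (pderiv i g) = c * eval P.rep (pderiv i f)) :
    ∃ p : MvPolynomial (Fin 3) ℝ, p.IsHomogeneous 3 ∧
      ∀ P ∈ T, SingAt (g + p * f) P := by
  have hf0 : f ≠ 0 := hsqf.ne_zero
  have hr : IsRelPrime f g := by
    intro d hdf hdg
    by_contra hd
    have hd0 : d ≠ 0 := fun h => hf0 (by rw [h] at hdf; exact zero_dvd_iff.1 hdf)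
    obtain ⟨π, hπ, hπd⟩ := WfDvdMonoid.exists_irreducible_factor hd hd0
    exact hcop π hπ (hπd.trans hdf) (hπd.trans hdg)
  have hu : ∀ P ∈ T, Good f g P.rep := fun P hP => ⟨hvan P hP, (htang P hP).1, (htang P hP).2⟩
  rcases hTcard with h8 | h9'
  · obtain ⟨e⟩ := enum (N := 8) h8
    refine finish e hu (surj8 hf3 hg6 hr (fun i => (e.symm i).1.rep_nonzero) ?_
      fun i => hu _ (e.symm i).2)
    intro i j hij
    exact rep_cr fun h => hij (e.symm.injective (Subtype.ext h))
  · obtain ⟨e⟩ := enum (N := 9) h9'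
    refine finish e hu (surj9 (f := f) ?_)
    intro h hh h0
    refine h9 h9' h hh fun P hP => ?_
    have := h0 (e ⟨P, hP⟩)
    simpa [VanishAt] using this

end
end

section
/- Let f ∈ ℝ[x₀,x₁,x₂] be a form of degree d and g a form of degree 2d. Let P ∈ ℙ²(ℝ) with representative u ∈ ℝ³ \ {0}. Assume: f(u) = 0 and ∇f(u) ≠ 0; g is singular at P (g(u) = 0 and ∇g(u) = 0); there exists v ∈ ℝ³ with v·∇f(u) = 0 and v ∉ ℝ·u such that vᵀ·(Hess g)(u)·v ≠ 0 (this expresses that the local intersection number i_P(f,g) equals 2, i.e. the tangent of the curve f = 0 at P is not a tangent of the curve g = 0 at P); and g is nonnegative at every point of the zero set of f in ℙ²(ℝ) lying in some neighborhood of P. Then there exist t > 0 and an open neighborhood U of P in ℙ²(ℝ) such that g + t·f² is nonnegative at every point of U. -/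
open MvPolynomial

noncomputable section

/-- The quotient topology on the real projective plane. -/
instance : TopologicalSpace P2 :=
  inferInstanceAs (TopologicalSpace (Quotient (projectivizationSetoid ℝ (Fin 3 → ℝ))))


/-- directional derivative -/
def DD (h : Fin 3 → ℝ) (p : MvPolynomial (Fin 3) ℝ) : MvPolynomial (Fin 3) ℝ :=
  ∑ i, C (h i) * pderiv i p

lemma DD_eval (h x : Fin 3 → ℝ) (p : MvPolynomial (Fin 3) ℝ) :
    eval x (DD h p) = ∑ i, h i * eval x (pderiv i p) := by
  simp [DD, map_sum]

lemma DD_comb (v w : Fin 3 → ℝ) (a b : ℝ) (p : MvPolynomial (Fin 3) ℝ) :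
    DD (a • v + b • w) p = C a * DD v p + C b * DD w p := by
  simp only [DD, Fin.sum_univ_three, Pi.add_apply, Pi.smul_apply, smul_eq_mul, map_add, map_mul]
  ring

lemma DD_add (h : Fin 3 → ℝ) (p q : MvPolynomial (Fin 3) ℝ) :
    DD h (p + q) = DD h p + DD h q := by
  simp only [DD, Fin.sum_univ_three, map_add]
  ring

lemma DD_mul (h : Fin 3 → ℝ) (p q : MvPolynomial (Fin 3) ℝ) :
    DD h (p * q) = DD h p * q + p * DD h q := by
  simp only [DD, Fin.sum_univ_three, Derivation.leibniz, smul_eq_mul]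
  ring

lemma DD_C (h : Fin 3 → ℝ) (c : ℝ) : DD h (C c) = 0 := by
  simp [DD]

lemma DD_Cmul (h : Fin 3 → ℝ) (c : ℝ) (p : MvPolynomial (Fin 3) ℝ) :
    DD h (C c * p) = C c * DD h p := by
  simp [DD_mul, DD_C]

lemma DD_X (h : Fin 3 → ℝ) (i : Fin 3) : DD h (X i) = C (h i) := by
  simp [DD, pderiv_X, Pi.single_apply]

lemma DD_hasDeriv (x h : Fin 3 → ℝ) (p : MvPolynomial (Fin 3) ℝ) (s : ℝ) :
    HasDerivAt (fun s : ℝ => eval (x + s • h) p) (eval (x + s • h) (DD h p)) s := by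
  induction p using MvPolynomial.induction_on with
  | C a => simpa [DD_C] using hasDerivAt_const s a
  | add p q hp hq => simpa [DD_add] using hp.fun_add hq
  | mul_X p i hp =>
    have h1 : HasDerivAt (fun s : ℝ => x i + s * h i) (h i) s := by
      simpa using ((hasDerivAt_id s).mul_const (h i)).const_add (x i)
    have := hp.fun_mul h1
    simpa [DD_mul, DD_X] using this

lemma taylor2 (x h : Fin 3 → ℝ) (p : MvPolynomial (Fin 3) ℝ) (h0 : eval x p = 0)
    (h1 : eval x (DD h p) = 0) :
    ∃ θ : ℝ, 0 < θ ∧ θ < 1 ∧ eval (x + h) p = eval (x + θ • h) (DD h (DD h p)) / 2 := by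
  have d1 := DD_hasDeriv x h p
  have d2 := DD_hasDeriv x h (DD h p)
  have d3 : ∀ s : ℝ, HasDerivAt (fun s : ℝ => s ^ 2) (2 * s) s := fun s => by
    simpa using hasDerivAt_pow 2 s
  obtain ⟨ξ, hξ, e1⟩ := exists_ratio_hasDerivAt_eq_ratio_slope _ _ (zero_lt_one (α := ℝ))
    (continuousOn_of_forall_continuousAt fun s _ => (d1 s).continuousAt) (fun s _ => d1 s)
    _ _ (continuousOn_of_forall_continuousAt fun s _ => (d3 s).continuousAt) (fun s _ => d3 s)
  obtain ⟨η, hη, e2⟩ := exists_hasDerivAt_eq_slope _ _ hξ.1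
    (continuousOn_of_forall_continuousAt fun s _ => (d2 s).continuousAt) (fun s _ => d2 s)
  refine ⟨η, hη.1, hη.2.trans hξ.2, ?_⟩
  have hp := hξ.1
  rw [eq_div_iff (by simpa using hp.ne')] at e2
  simp [h0, h1] at e1 e2
  have : ξ * (2 * eval (x + h) p) = ξ * eval (x + η • h) (DD h (DD h p)) := by linarith
  have := mul_left_cancel₀ hp.ne' this
  linarith

lemma eval_smul_hom {n : ℕ} {p : MvPolynomial (Fin 3) ℝ} (hp : p.IsHomogeneous n) (c : ℝ)
    (x : Fin 3 → ℝ) : eval (c • x) p = c ^ n * eval x p := by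
  rw [eval_eq, eval_eq, Finset.mul_sum]
  refine Finset.sum_congr rfl fun m hm => ?_
  have h1 := hp.degree_eq_sum_deg_support hm
  simp only [Pi.smul_apply, smul_eq_mul, mul_pow, Finset.prod_mul_distrib,
    Finset.prod_pow_eq_pow_sum]
  rw [h1]
  ring

lemma euler0 {n : ℕ} {p : MvPolynomial (Fin 3) ℝ} (hp : p.IsHomogeneous n)
    (x : Fin 3 → ℝ) (h0 : eval x p = 0) : eval x (DD x p) = 0 := by
  have := hp.sum_X_mul_pderiv
  have := congrArg (eval x) this
  simpa [DD, h0] using this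

/-- second-order expansion of the form -/
lemma DD2_comb (v w x : Fin 3 → ℝ) (a b : ℝ) (p : MvPolynomial (Fin 3) ℝ) :
    eval x (DD (a • v + b • w) (DD (a • v + b • w) p)) =
      a ^ 2 * eval x (DD v (DD v p)) + a * b * (eval x (DD v (DD w p)) + eval x (DD w (DD v p)))
        + b ^ 2 * eval x (DD w (DD w p)) := by
  simp only [DD_comb, DD_add, DD_Cmul, map_add, map_mul, eval_C]
  ring

lemma eval_cont (p : MvPolynomial (Fin 3) ℝ) : Continuous fun x : Fin 3 → ℝ => eval x p :=
  MvPolynomial.continuous_eval p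

lemma rep_scale (x : Fin 3 → ℝ) (hx : x ≠ 0) :
    ∃ c : ℝ, c ≠ 0 ∧ (Projectivization.mk ℝ x hx).rep = c • x := by
  obtain ⟨a, ha⟩ := Projectivization.exists_smul_eq_mk_rep ℝ x hx
  exact ⟨a, a.ne_zero, ha.symm⟩

lemma isOpen_P2 (U : Set P2) :
    IsOpen U ↔ IsOpen {x : {x : Fin 3 → ℝ // x ≠ 0} | Projectivization.mk ℝ x.1 x.2 ∈ U} :=
  Iff.rfl

/-- Points of the curve near `u`, close to the tangent direction. -/
lemma curve_points (f : MvPolynomial (Fin 3) ℝ) (u v w : Fin 3 → ℝ) (hfu : eval u f = 0)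
    (hv : eval u (DD v f) = 0) (hw : 0 < eval u (DD w f)) (ε : ℝ) (hε : 0 < ε) :
    ∀ᶠ a in nhdsWithin (0 : ℝ) (Set.Ioi 0), ∃ s ∈ Set.Icc (-ε) ε,
      eval (u + a • (v + s • w)) f = 0 := by
  have key : ∀ s : ℝ, HasDerivAt (fun a : ℝ => eval (u + a • (v + s • w)) f)
      (s * eval u (DD w f)) 0 := by
    intro s
    have := DD_hasDeriv u (v + s • w) f 0
    have e : v + s • w = (1 : ℝ) • v + s • w := by simp
    simpa [e, DD_comb, hv] using this
  have hpos : ∀ᶠ a in nhdsWithin (0 : ℝ) (Set.Ioi 0), 0 < eval (u + a • (v + ε • w)) f := by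
    have := ((hasDerivAt_iff_tendsto_slope.1 (key ε)).mono_left (nhdsWithin_mono _ fun a (ha : 0 < a) => ha.ne')).eventually_const_lt (mul_pos hε hw)
    filter_upwards [this, self_mem_nhdsWithin] with a h1 h2
    have h2 : 0 < a := h2
    simp only [slope_def_field, zero_smul, add_zero, hfu, sub_zero] at h1
    exact (div_pos_iff_of_pos_right h2).1 h1
  have hneg : ∀ᶠ a in nhdsWithin (0 : ℝ) (Set.Ioi 0), eval (u + a • (v + (-ε) • w)) f < 0 := by
    have := ((hasDerivAt_iff_tendsto_slope.1 (key (-ε))).mono_left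
      (nhdsWithin_mono _ fun a (ha : 0 < a) => ha.ne')).eventually_lt_const
      (show _ < (0:ℝ) by nlinarith)
    filter_upwards [this, self_mem_nhdsWithin] with a h1 h2
    have h2 : 0 < a := h2
    simp only [slope_def_field, zero_smul, add_zero, hfu, sub_zero] at h1
    by_contra h3
    exact absurd (div_nonneg (not_lt.1 h3) h2.le) (not_le.2 h1)
  filter_upwards [hpos, hneg] with a h1 h2
  have hc : Continuous fun s : ℝ => eval (u + a • (v + s • w)) f :=
    (eval_cont f).comp (by fun_prop)
  exact intermediate_value_Icc (by linarith) hc.continuousOn ⟨h2.le, h1.le⟩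

/-- Local nonnegativity on the curve forces positivity of the Hessian in the tangent direction. -/
lemma tangent_pos (f g : MvPolynomial (Fin 3) ℝ) (u v w : Fin 3 → ℝ) (hfu : eval u f = 0)
    (hv : eval u (DD v f) = 0) (hw : 0 < eval u (DD w f))
    (hgu : eval u g = 0) (hgD : ∀ h, eval u (DD h g) = 0)
    (hloc : ∀ᶠ x in nhds u, eval x f = 0 → 0 ≤ eval x g)
    (hne : eval u (DD v (DD v g)) ≠ 0) : 0 < eval u (DD v (DD v g)) := by
  by_contra hcon
  have hlt : eval u (DD v (DD v g)) < 0 := lt_of_le_of_ne (not_lt.1 hcon) hne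
  set R : (Fin 3 → ℝ) × ℝ → ℝ := fun z => eval z.1 (DD v (DD v g)) +
    z.2 * (eval z.1 (DD v (DD w g)) + eval z.1 (DD w (DD v g))) +
    z.2 ^ 2 * eval z.1 (DD w (DD w g)) with hR
  have hRc : Continuous R := by
    have h1 := fun p => (eval_cont p).comp (continuous_fst (X := Fin 3 → ℝ) (Y := ℝ))
    have h2 := h1 (DD v (DD v g))
    have h3 := h1 (DD v (DD w g))
    have h4 := h1 (DD w (DD v g))
    have h5 := h1 (DD w (DD w g))
    exact (h2.add (continuous_snd.mul (h3.add h4))).add ((continuous_snd.pow 2).mul h5)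
  have hRe : ∀ᶠ z in nhds (u, (0:ℝ)), R z < 0 := by
    refine hRc.continuousAt.eventually_lt_const ?_
    simpa [hR] using hlt
  obtain ⟨δ, hδ, hball⟩ := Metric.eventually_nhds_iff.1 hRe
  have hε : 0 < δ / 2 := by linarith
  have hev : ∀ᶠ q : ℝ × ℝ in nhds (0, 0), True := by simp
  obtain ⟨r, hr, hloc⟩ := Metric.eventually_nhds_iff.1 hloc
  set M : ℝ := ‖v‖ + δ / 2 * ‖w‖ + 1 with hM
  have hM0 : 0 < M := by positivity
  have hsm : ∀ᶠ a in nhdsWithin (0 : ℝ) (Set.Ioi 0), a * M < min r δ := by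
    apply Filter.Eventually.filter_mono nhdsWithin_le_nhds
    refine (continuous_id.mul continuous_const).continuousAt.eventually_lt_const ?_
    simp [hr, hδ]
  obtain ⟨a, ⟨⟨s, hs, hfs⟩, hsm⟩, ha⟩ :=
    (((curve_points f u v w hfu hv hw _ hε).and hsm).and self_mem_nhdsWithin).exists
  have ha : 0 < a := ha
  have hs' : |s| ≤ δ / 2 := abs_le.2 hs
  have hnorm : ‖v + s • w‖ < M := by
    have h1 := norm_add_le v (s • w)
    rw [norm_smul, Real.norm_eq_abs] at h1
    have := mul_le_mul_of_nonneg_right hs' (norm_nonneg w)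
    linarith
  have hdist : ∀ θ : ℝ, 0 < θ → θ ≤ 1 → dist (u + θ • a • (v + s • w)) u < min r δ := by
    intro θ h0 h1
    rw [dist_eq_norm, add_sub_cancel_left, norm_smul, norm_smul, Real.norm_of_nonneg h0.le,
      Real.norm_of_nonneg ha.le]
    have : a * ‖v + s • w‖ ≤ a * M := by gcongr
    have h2 : 0 ≤ a * ‖v + s • w‖ := by positivity
    nlinarith
  have hge := hloc (by simpa using (hdist 1 one_pos le_rfl).trans_le (min_le_left _ _)) hfs
  obtain ⟨θ, h0, h1, he⟩ := taylor2 u (a • (v + s • w)) g hgu (hgD _)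
  have hRneg := hball (y := (u + θ • a • (v + s • w), s)) (by
    rw [Prod.dist_eq, max_lt_iff]
    refine ⟨(hdist θ h0 h1.le).trans_le (min_le_right _ _), ?_⟩
    rw [Real.dist_eq]
    simp only [sub_zero]
    linarith)
  have e : a • (v + s • w) = a • v + (a * s) • w := by rw [smul_add, smul_smul]
  rw [e, DD2_comb] at he
  rw [e] at hRneg hge
  simp only [hR] at hRneg
  rw [he] at hge
  have : 0 < a ^ 2 := by positivity
  nlinarith

/-- If the Hessian is positive definite on the span of `v, w` then `p` is nonnegative nearby. -/
lemma local_nonneg (p : MvPolynomial (Fin 3) ℝ) (u v w : Fin 3 → ℝ)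
    (hp : eval u p = 0) (hD : ∀ h, eval u (DD h p) = 0)
    (hA : 0 < eval u (DD v (DD v p)))
    (hdet : (eval u (DD v (DD w p)) + eval u (DD w (DD v p))) ^ 2 <
      4 * eval u (DD v (DD v p)) * eval u (DD w (DD w p))) :
    ∃ δ : ℝ, 0 < δ ∧ ∀ a b : ℝ, |a| < δ → |b| < δ → 0 ≤ eval (u + (a • v + b • w)) p := by
  have c1 := eval_cont (DD v (DD v p))
  have c2 := eval_cont (DD v (DD w p))
  have c3 := eval_cont (DD w (DD v p))
  have c4 := eval_cont (DD w (DD w p))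
  have e1 := c1.continuousAt.eventually_const_lt hA
  have e2 : ∀ᶠ x in nhds u, (eval x (DD v (DD w p)) + eval x (DD w (DD v p))) ^ 2 <
      4 * eval x (DD v (DD v p)) * eval x (DD w (DD w p)) :=
    ContinuousAt.eventually_lt ((c2.add c3).pow 2).continuousAt
      ((continuous_const.mul c1).mul c4).continuousAt hdet
  obtain ⟨r, hr, hball⟩ := Metric.eventually_nhds_iff.1 (e1.and e2)
  have hM0 : 0 < ‖v‖ + ‖w‖ + 1 := by positivity
  refine ⟨r / (‖v‖ + ‖w‖ + 1), by positivity, fun a b ha hb => ?_⟩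
  obtain ⟨θ, h0, h1, he⟩ := taylor2 u (a • v + b • w) p hp (hD _)
  have hn : ‖a • v + b • w‖ < r := by
    have k1 := norm_add_le (a • v) (b • w)
    rw [norm_smul, norm_smul, Real.norm_eq_abs, Real.norm_eq_abs] at k1
    have k2 := mul_le_mul_of_nonneg_right ha.le (norm_nonneg v)
    have k3 := mul_le_mul_of_nonneg_right hb.le (norm_nonneg w)
    have k4 : r / (‖v‖ + ‖w‖ + 1) * (‖v‖ + ‖w‖ + 1) = r := by field_simp
    have k5 : 0 < r / (‖v‖ + ‖w‖ + 1) := by positivity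
    nlinarith
  obtain ⟨q1, q2⟩ := hball (y := u + θ • (a • v + b • w)) (by
    rw [dist_eq_norm, add_sub_cancel_left, norm_smul, Real.norm_of_nonneg h0.le]
    nlinarith [norm_nonneg (a • v + b • w)])
  rw [he, DD2_comb]
  set x := u + θ • (a • v + b • w)
  generalize eval x (DD v (DD v p)) = A at *
  generalize eval x (DD v (DD w p)) + eval x (DD w (DD v p)) = B at *
  generalize eval x (DD w (DD w p)) = D at *
  have : 0 ≤ 4 * A * (a ^ 2 * A + a * b * B + b ^ 2 * D) := by
    nlinarith [sq_nonneg (2 * A * a + B * b), mul_nonneg (sq_nonneg b) (sub_nonneg.2 q2.le)]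
  have := nonneg_of_mul_nonneg_right this (by linarith)
  linarith

lemma choose_t (A B D N : ℝ) (hA : 0 < A) (hw : 0 < N) :
    ∃ t : ℝ, 0 < t ∧ B ^ 2 < 4 * A * (D + 2 * t * N ^ 2) := by
  refine ⟨(B ^ 2 + 4 * A * |D| + 1) / (8 * A * N ^ 2), by positivity, ?_⟩
  have : 4 * A * (D + 2 * ((B ^ 2 + 4 * A * |D| + 1) / (8 * A * N ^ 2)) * N ^ 2) =
    4 * A * D + (B ^ 2 + 4 * A * |D| + 1) := by
    field_simp
    ring
  rw [this]
  nlinarith [neg_abs_le D]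

theorem statement15 (d : ℕ) (f g : MvPolynomial (Fin 3) ℝ)
    (hf : f.IsHomogeneous d) (hg : g.IsHomogeneous (2 * d))
    (P : P2) (u : Fin 3 → ℝ) (hu : u ≠ 0) (hrep : Projectivization.mk ℝ u hu = P)
    (hfu : eval u f = 0) (hgradf : ∃ i, eval u (pderiv i f) ≠ 0)
    (hgu : eval u g = 0) (hgradg : ∀ i, eval u (pderiv i g) = 0)
    (htrans : ∃ v : Fin 3 → ℝ, (∑ i, v i * eval u (pderiv i f)) = 0 ∧
      (¬ ∃ c : ℝ, v = c • u) ∧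
      (∑ i, ∑ j, v i * eval u (pderiv i (pderiv j g)) * v j) ≠ 0)
    (hlocpsd : ∃ W : Set P2, IsOpen W ∧ P ∈ W ∧
      ∀ Q ∈ W, VanishAt f Q → 0 ≤ eval Q.rep g) :
    ∃ t : ℝ, 0 < t ∧ ∃ U : Set P2, IsOpen U ∧ P ∈ U ∧
      ∀ Q ∈ U, 0 ≤ eval Q.rep (g + t • f ^ 2) := by
  obtain ⟨v, hv, hvu, hvg⟩ := htrans
  obtain ⟨i₀, hi₀⟩ := hgradf
  obtain ⟨W, hWo, hPW, hW⟩ := hlocpsd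
  set w : Fin 3 → ℝ := fun i => eval u (pderiv i f) with hwdef
  have hw : 0 < eval u (DD w f) := by
    rw [DD_eval]
    refine Finset.sum_pos' (fun i _ => mul_self_nonneg _) ⟨i₀, Finset.mem_univ _, ?_⟩
    exact mul_self_pos.2 hi₀
  have hvf : eval u (DD v f) = 0 := by rw [DD_eval]; exact hv
  have huf : eval u (DD u f) = 0 := euler0 hf u hfu
  have hgD : ∀ h, eval u (DD h g) = 0 := fun h => by simp [DD_eval, hgradg]
  have hvv : eval u (DD v (DD v g)) ≠ 0 := by
    convert hvg using 1
    simp only [DD_eval]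
    refine Finset.sum_congr rfl fun i _ => ?_
    simp only [DD, map_sum, Derivation.leibniz, pderiv_C, smul_eq_mul, map_add, map_mul, eval_C,
      Finset.mul_sum]
    refine Finset.sum_congr rfl fun j _ => ?_
    simp
    ring
  -- local nonnegativity on the curve upstairs
  have hloc : ∀ᶠ x in nhds u, eval x f = 0 → 0 ≤ eval x g := by
    have h1 := (isOpen_P2 W).1 hWo
    obtain ⟨V, hV, hVW⟩ := isOpen_induced_iff.1 h1
    have huV : u ∈ V := by
      have : (⟨u, hu⟩ : {x : Fin 3 → ℝ // x ≠ 0}) ∈ Subtype.val ⁻¹' V := by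
        rw [hVW]; show Projectivization.mk ℝ u hu ∈ W; rw [hrep]; exact hPW
      exact this
    filter_upwards [hV.mem_nhds huV, isOpen_ne.mem_nhds hu] with x hxV hx0 hfx
    have hxW : Projectivization.mk ℝ x hx0 ∈ W := by
      have : (⟨x, hx0⟩ : {x : Fin 3 → ℝ // x ≠ 0}) ∈ Subtype.val ⁻¹' V := hxV
      rw [hVW] at this; exact this
    obtain ⟨c, hc, hcx⟩ := rep_scale x hx0
    have h2 := hW _ hxW (by unfold VanishAt; rw [hcx, eval_smul_hom hf, hfx, mul_zero])
    rw [hcx, eval_smul_hom hg, pow_mul] at h2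
    exact nonneg_of_mul_nonneg_right h2 (by positivity)
  have hA := tangent_pos f g u v w hfu hvf hw hgu hgD hloc hvv
  -- choice of t
  set A := eval u (DD v (DD v g)) with hAdef
  set B := eval u (DD v (DD w g)) + eval u (DD w (DD v g)) with hBdef
  set D := eval u (DD w (DD w g)) with hDdef
  set N := eval u (DD w f) with hNdef
  obtain ⟨t, ht, htdet⟩ : ∃ t : ℝ, 0 < t ∧ B ^ 2 < 4 * A * (D + 2 * t * N ^ 2) :=
    choose_t A B D N hA hw
  have hq : (g + t • f ^ 2).IsHomogeneous (2 * d) := by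
    refine hg.add ?_
    rw [smul_eq_C_mul, mul_comm 2 d]
    simpa using (isHomogeneous_C (Fin 3) t).mul (hf.pow 2)
  have hDp : ∀ h, DD h (g + t • f ^ 2) = DD h g + C t * (DD h f * f + f * DD h f) := by
    intro h
    rw [smul_eq_C_mul, DD_add, DD_Cmul, pow_two, DD_mul]
  have hDDp : ∀ h k, eval u (DD k (DD h (g + t • f ^ 2))) =
      eval u (DD k (DD h g)) + 2 * t * eval u (DD h f) * eval u (DD k f) := by
    intro h k
    rw [hDp, DD_add, DD_Cmul, DD_add, DD_mul, DD_mul]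
    simp only [map_add, map_mul, eval_C, hfu]
    ring
  obtain ⟨δ, hδ, hnn⟩ := local_nonneg (g + t • f ^ 2) u v w (by simp [hgu, hfu, smul_eq_C_mul])
    (fun h => by rw [hDp]; simp [hgD, hfu])
    (by rw [hDDp, hvf]; simpa using hA)
    (by
      simp only [hDDp, hvf]
      simp only [mul_zero, zero_mul, add_zero]
      convert htdet using 2
      ring)
  -- the basis u, v, w
  have hli : LinearIndependent ℝ ![u, v, w] := by
    rw [Fintype.linearIndependent_iff]
    intro c hc
    simp only [Fin.sum_univ_three, Matrix.cons_val_zero, Matrix.cons_val_one,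
      Matrix.cons_val] at hc
    have h2 : c 2 = 0 := by
      have e : DD (c 0 • u + c 1 • v + c 2 • w) f = 0 := by rw [hc]; simp [DD]
      have e1 : c 0 • u + c 1 • v + c 2 • w = (1:ℝ) • (c 0 • u + c 1 • v) + c 2 • w := by simp
      rw [e1, DD_comb, DD_comb] at e
      have := congrArg (eval u) e
      simp [huf, hvf] at this
      exact this.resolve_right hw.ne'
    have h1 : c 1 = 0 := by
      by_contra h
      refine hvu ⟨-(c 0 / c 1), ?_⟩
      ext i
      have := congrFun hc i
      simp [h2] at this ⊢
      field_simp
      linarith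
    have h0 : c 0 = 0 := by
      simp [h1, h2] at hc
      exact hc.resolve_right hu
    intro i
    fin_cases i <;> assumption
  set bs := basisOfLinearIndependentOfCardEqFinrank hli (by simp) with hbs
  have hb0 : bs 0 = u := by simp [hbs]
  have hb1 : bs 1 = v := by simp [hbs]
  have hb2 : bs 2 = w := by simp [hbs]
  have hexp : ∀ x : Fin 3 → ℝ, x = bs.coord 0 x • u + bs.coord 1 x • v + bs.coord 2 x • w := by
    intro x
    have := bs.sum_repr x
    rw [Fin.sum_univ_three, hb0, hb1, hb2] at this
    exact this.symm
  have hcont : ∀ i, Continuous (bs.coord i) := fun i =>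
    LinearMap.continuous_of_finiteDimensional _
  set S : Set (Fin 3 → ℝ) := {x | |bs.coord 1 x| < δ * |bs.coord 0 x| ∧
    |bs.coord 2 x| < δ * |bs.coord 0 x|} with hS
  have hSo : IsOpen S := by
    have h0 := hcont 0
    have h1 := hcont 1
    have h2 := hcont 2
    exact (isOpen_lt h1.abs (continuous_const.mul h0.abs)).inter
      (isOpen_lt h2.abs (continuous_const.mul h0.abs))
  have hSs : ∀ (c : ℝ) (x), c ≠ 0 → (c • x ∈ S ↔ x ∈ S) := by
    intro c x hc
    have : 0 < |c| := abs_pos.2 hc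
    simp only [hS, Set.mem_ofPred_eq, map_smul, smul_eq_mul, abs_mul]
    rw [mul_left_comm, mul_lt_mul_iff_right₀ this, mul_lt_mul_iff_right₀ this]
  have hSrep : ∀ (x) (hx : x ≠ 0), (Projectivization.mk ℝ x hx).rep ∈ S ↔ x ∈ S := by
    intro x hx
    obtain ⟨c, hc, hcx⟩ := rep_scale x hx
    rw [hcx, hSs c x hc]
  refine ⟨t, ht, {Q | Q.rep ∈ S}, ?_, ?_, ?_⟩
  · rw [isOpen_P2]
    simp only [Set.mem_ofPred_eq, hSrep]
    exact hSo.preimage continuous_subtype_val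
  · rw [← hrep, Set.mem_ofPred_eq, hSrep]
    have h0 : bs.coord 0 u = 1 := by rw [← hb0]; simp
    have h1 : bs.coord 1 u = 0 := by rw [← hb0]; simp
    have h2 : bs.coord 2 u = 0 := by rw [← hb0]; simp
    simp only [hS, Set.mem_ofPred_eq, h0, h1, h2]
    simp [hδ]
  · intro Q hQ
    obtain ⟨k1, k2⟩ := hQ
    set x := Q.rep
    have hx := hexp x
    set α := bs.coord 0 x
    set β := bs.coord 1 x
    set γ := bs.coord 2 x
    have hα : 0 < |α| := by
      by_contra h
      nlinarith [abs_nonneg β, abs_nonneg α]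
    have hα0 : α ≠ 0 := abs_pos.1 hα
    have e : x = α • (u + ((β / α) • v + (γ / α) • w)) := by
      rw [hx]
      simp only [smul_add, smul_smul, mul_div_cancel₀ _ hα0, add_assoc]
    rw [e, eval_smul_hom hq, pow_mul]
    refine mul_nonneg (by positivity) (hnn _ _ ?_ ?_)
    · rw [abs_div, div_lt_iff₀ hα]; exact k1
    · rw [abs_div, div_lt_iff₀ hα]; exact k2

end
end

section
/- Let T ⊂ ℙ²(ℂ) be a set of exactly 8 points such that no 4 points of T lie on a line and no 7 points of T lie on a conic. Let f, f' be cubic forms in ℂ[x₀,x₁,x₂] spanning the space I₃(T) of cubics vanishing on T, and let g be a sextic form such that f², ff', f'², g span the space I₆(2T) of sextics singular at every point of T. Then the Jacobian determinant j = det J(f,f',g) (the determinant of the 3×3 matrix of first partial derivatives of f, f', g) is a nonzero form of degree 9. Moreover, for any other choice of such data f̃, f̃', g̃ satisfying the same spanning conditions, det J(f̃,f̃',g̃) = c·j for some nonzero constant c ∈ ℂ; i.e. the degree-9 curve N_T = V(j) depends only on T. -/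
open MvPolynomial

noncomputable section

/-- The complex projective plane, as lines through the origin of `ℂ³`. -/
abbrev P2C := Projectivization ℂ (Fin 3 → ℂ)

/-- A form vanishes at a point of `ℙ²(ℂ)` if it vanishes at a representative vector. -/
def VanishAtC (g : MvPolynomial (Fin 3) ℂ) (P : P2C) : Prop := eval P.rep g = 0

/-- A form is singular at a point of `ℙ²(ℂ)` if it and all its first partial
derivatives vanish at a representative vector. -/
def SingAtC (g : MvPolynomial (Fin 3) ℂ) (P : P2C) : Prop :=
  eval P.rep g = 0 ∧ ∀ i, eval P.rep (pderiv i g) = 0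

/-- `I_d(T)` over `ℂ`: the space of degree-`d` forms vanishing at every point of `T`. -/
def IsubC (d : ℕ) (T : Set P2C) : Submodule ℂ (MvPolynomial (Fin 3) ℂ) :=
  (homogeneousSubmodule (Fin 3) ℂ d) ⊓
  { carrier := {f | ∀ P ∈ T, VanishAtC f P}
    zero_mem' := by intro P _; simp [VanishAtC]
    add_mem' := by
      intro a b ha hb P hP
      have h1 := ha P hP; have h2 := hb P hP
      unfold VanishAtC at *; simp [h1, h2]
    smul_mem' := by
      intro c f hf P hP
      have h1 := hf P hP
      unfold VanishAtC at *; simp [smul_eq_C_mul, h1] }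

/-- `I_d(2T)` over `ℂ`: the space of degree-`d` forms singular at every point of `T`. -/
def Isub2C (d : ℕ) (T : Set P2C) : Submodule ℂ (MvPolynomial (Fin 3) ℂ) :=
  (homogeneousSubmodule (Fin 3) ℂ d) ⊓
  { carrier := {f | ∀ P ∈ T, SingAtC f P}
    zero_mem' := by intro P _; constructor <;> simp [SingAtC]
    add_mem' := by
      intro a b ha hb P hP
      obtain ⟨h1, h2⟩ := ha P hP; obtain ⟨h3, h4⟩ := hb P hP
      exact ⟨by simp [h1, h3], fun i => by simp [h2 i, h4 i]⟩
    smul_mem' := by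
      intro c f hf P hP
      obtain ⟨h1, h2⟩ := hf P hP
      refine ⟨by simp [smul_eq_C_mul, h1], fun i => ?_⟩
      have := h2 i
      simp [smul_eq_C_mul, this] }

/-- No 4 points of `T` on a line, no 7 on a conic (over `ℂ`). -/
def GenPosC (T : Set P2C) : Prop :=
  (∀ l : MvPolynomial (Fin 3) ℂ, l ≠ 0 → l.IsHomogeneous 1 →
    {P ∈ T | VanishAtC l P}.encard ≤ 3) ∧
  (∀ c : MvPolynomial (Fin 3) ℂ, c ≠ 0 → c.IsHomogeneous 2 →
    {P ∈ T | VanishAtC c P}.encard ≤ 6)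

/-- The Jacobian determinant of three forms. -/
def jacC (f f' g : MvPolynomial (Fin 3) ℂ) : MvPolynomial (Fin 3) ℂ :=
  Matrix.det (Matrix.of fun i j => pderiv j (![f, f', g] i))

abbrev Poly3 := MvPolynomial (Fin 3) ℂ

/-- Grading homomorphism `x_i ↦ x_i λ`. -/
def gradHom : Poly3 →ₐ[ℂ] Polynomial Poly3 :=
  aeval (fun i => Polynomial.C (X i) * Polynomial.X)

lemma gradHom_monomial (s : Fin 3 →₀ ℕ) (c : ℂ) :
    gradHom (monomial s c) = Polynomial.C (monomial s c) * Polynomial.X ^ (s.degree) := by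
  unfold gradHom
  rw [aeval_monomial, Finsupp.prod_fintype _ _ (by simp), monomial_eq,
    Finsupp.prod_fintype _ _ (by simp), Finsupp.degree_eq_sum]
  simp only [mul_pow, Finset.prod_mul_distrib, Finset.prod_pow_eq_pow_sum, map_mul, map_prod, map_pow]
  rw [mul_assoc]; rfl

lemma gradHom_coeff (p : Poly3) (n : ℕ) : (gradHom p).coeff n = homogeneousComponent n p := by
  induction p using MvPolynomial.induction_on' with
  | monomial s c =>
    rw [gradHom_monomial, Polynomial.coeff_C_mul, Polynomial.coeff_X_pow,
      homogeneousComponent_of_mem (m := n) (n := s.degree) (by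
        rw [mem_homogeneousSubmodule]; exact isHomogeneous_monomial _ rfl)]
    split_ifs <;> simp
  | add p q hp hq => rw [map_add, Polynomial.coeff_add, map_add, hp, hq]

lemma gradHom_ne_zero {p : Poly3} (hp : p ≠ 0) : gradHom p ≠ 0 := by
  intro h
  apply hp
  rw [← sum_homogeneousComponent p]
  apply Finset.sum_eq_zero
  intro i _
  rw [← gradHom_coeff, h]; simp

lemma homog_factor {a b : Poly3} {d : ℕ} (h : (a * b).IsHomogeneous d) (hne : a * b ≠ 0) :
    ∃ m n, m + n = d ∧ a.IsHomogeneous m ∧ b.IsHomogeneous n := by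
  have ha := gradHom_ne_zero (left_ne_zero_of_mul hne)
  have hb := gradHom_ne_zero (right_ne_zero_of_mul hne)
  have hab : gradHom a * gradHom b = Polynomial.C (a * b) * Polynomial.X ^ d := by
    rw [← map_mul]
    ext1 n
    rw [gradHom_coeff, homogeneousComponent_of_mem (m := n) (n := d) (by
        rw [mem_homogeneousSubmodule]; exact h), Polynomial.coeff_C_mul, Polynomial.coeff_X_pow]
    split_ifs <;> simp
  have h1 := congrArg Polynomial.natDegree hab
  have h2 := congrArg Polynomial.natTrailingDegree hab
  rw [Polynomial.natDegree_mul ha hb, Polynomial.natDegree_C_mul_X_pow _ _ hne] at h1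
  rw [Polynomial.natTrailingDegree_mul ha hb, Polynomial.C_mul_X_pow_eq_monomial,
    Polynomial.natTrailingDegree_monomial hne] at h2
  have h3 := Polynomial.natTrailingDegree_le_natDegree (gradHom a)
  have h4 := Polynomial.natTrailingDegree_le_natDegree (gradHom b)
  have key : ∀ p : Poly3, (gradHom p).natTrailingDegree = (gradHom p).natDegree →
      p.IsHomogeneous (gradHom p).natDegree := by
    intro p hp
    intro s hs
    by_contra hne'
    apply hs
    have h5 : (gradHom p).coeff s.degree = 0 := by
      rcases lt_or_gt_of_ne (show s.degree ≠ (gradHom p).natDegree by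
        rw [Finsupp.degree_eq_weight_one]; exact hne') with h | h
      · exact Polynomial.coeff_eq_zero_of_lt_natTrailingDegree (by omega)
      · exact Polynomial.coeff_eq_zero_of_natDegree_lt h
    rw [gradHom_coeff] at h5
    have := coeff_homogeneousComponent (s.degree) p s
    rw [h5] at this
    simpa using this.symm
  exact ⟨_, _, h1, key a (by omega), key b (by omega)⟩

lemma const_of_homog_zero {a : Poly3} (h : a.IsHomogeneous 0) : ∃ c : ℂ, a = C c := by
  rw [← totalDegree_zero_iff_isHomogeneous] at h
  exact ⟨_, totalDegree_eq_zero_iff_eq_C.mp h⟩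

lemma isUnit_of_homog_zero {a : Poly3} (h : a.IsHomogeneous 0) (h0 : a ≠ 0) : IsUnit a := by
  obtain ⟨c, rfl⟩ := const_of_homog_zero h
  have : c ≠ 0 := by rintro rfl; simp at h0
  exact (IsUnit.mk0 c this).map C

lemma homog_of_mul {a b : Poly3} {m d : ℕ} (ha : a.IsHomogeneous m) (ha0 : a ≠ 0)
    (h : (a * b).IsHomogeneous (m + d)) : b.IsHomogeneous d := by
  by_cases hb : b = 0
  · subst hb; exact isHomogeneous_zero _ _ _
  obtain ⟨m', n', h1, h2, h3⟩ := homog_factor h (mul_ne_zero ha0 hb)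
  have := h2.inj_right ha ha0
  have : n' = d := by omega
  rwa [← this]

/-- A nonzero cubic form with no linear factor is irreducible. -/
lemma cubic_irreducible {F : Poly3} (hF : F.IsHomogeneous 3) (h0 : F ≠ 0)
    (hl : ∀ l q : Poly3, l.IsHomogeneous 1 → q.IsHomogeneous 2 → F ≠ l * q) : Irreducible F := by
  constructor
  · intro hu
    have h1 : F.IsHomogeneous 0 := by
      obtain ⟨b, hb⟩ := hu.exists_right_inv
      obtain ⟨m', n', h1, h2, h3⟩ := homog_factor (d := 0) (by rw [hb]; exact isHomogeneous_one _ _)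
        (by rw [hb]; exact one_ne_zero)
      have : m' = 0 := by omega
      rwa [this] at h2
    have := hF.inj_right h1 h0
    omega
  · rintro a b rfl
    obtain ⟨m, n, h1, h2, h3⟩ := homog_factor hF h0
    have ha := left_ne_zero_of_mul h0
    have hb := right_ne_zero_of_mul h0
    have hm : m ≤ 3 := by omega
    interval_cases m
    · exact Or.inl (isUnit_of_homog_zero h2 ha)
    · obtain rfl : n = 2 := by omega
      exact absurd rfl (hl a b h2 h3)
    · obtain rfl : n = 1 := by omega
      exact absurd (mul_comm a b) (hl b a h3 h2)
    · obtain rfl : n = 0 := by omega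
      exact Or.inr (isUnit_of_homog_zero h3 hb)

lemma linear_irreducible {F : Poly3} (hF : F.IsHomogeneous 1) (h0 : F ≠ 0) : Irreducible F := by
  constructor
  · intro hu
    have h1 : F.IsHomogeneous 0 := by
      obtain ⟨b, hb⟩ := hu.exists_right_inv
      obtain ⟨m', n', h1, h2, h3⟩ := homog_factor (d := 0) (by rw [hb]; exact isHomogeneous_one _ _)
        (by rw [hb]; exact one_ne_zero)
      have : m' = 0 := by omega
      rwa [this] at h2
    have := hF.inj_right h1 h0
    omega
  · rintro a b rfl
    obtain ⟨m, n, h1, h2, h3⟩ := homog_factor hF h0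
    have ha := left_ne_zero_of_mul h0
    have hb := right_ne_zero_of_mul h0
    have hm : m ≤ 1 := by omega
    interval_cases m
    · exact Or.inl (isUnit_of_homog_zero h2 ha)
    · obtain rfl : n = 0 := by omega
      exact Or.inr (isUnit_of_homog_zero h3 hb)

/-- The linear form through two vectors. -/
def lin (p q : Fin 3 → ℂ) : Poly3 :=
  C (p 1 * q 2 - p 2 * q 1) * X 0 + C (p 2 * q 0 - p 0 * q 2) * X 1 +
    C (p 0 * q 1 - p 1 * q 0) * X 2

lemma lin_homog (p q : Fin 3 → ℂ) : (lin p q).IsHomogeneous 1 :=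
  ((isHomogeneous_C_mul_X _ _).add (isHomogeneous_C_mul_X _ _)).add (isHomogeneous_C_mul_X _ _)

lemma lin_eval (p q x : Fin 3 → ℂ) : eval x (lin p q) =
    (p 1 * q 2 - p 2 * q 1) * x 0 + (p 2 * q 0 - p 0 * q 2) * x 1 +
    (p 0 * q 1 - p 1 * q 0) * x 2 := by simp [lin]

/-- Coefficients of a linear form. -/
lemma linear_form {l : Poly3} (hl : l.IsHomogeneous 1) :
    ∃ a : Fin 3 → ℂ, l = C (a 0) * X 0 + C (a 1) * X 1 + C (a 2) * X 2 := by
  have := (mem_homogeneousSubmodule 1 l).mpr hl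
  rw [homogeneousSubmodule_one_eq_span_X, Submodule.mem_span_range_iff_exists_fun] at this
  obtain ⟨a, ha⟩ := this
  refine ⟨a, ?_⟩
  rw [← ha, Fin.sum_univ_three]
  simp [smul_eq_C_mul]

def Indep (p q : Fin 3 → ℂ) : Prop := ∀ s t : ℂ, s • p + t • q = 0 → s = 0 ∧ t = 0

lemma indep_cross {p q : Fin 3 → ℂ} (h : Indep p q) :
    p 1 * q 2 - p 2 * q 1 ≠ 0 ∨ p 2 * q 0 - p 0 * q 2 ≠ 0 ∨ p 0 * q 1 - p 1 * q 0 ≠ 0 := by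
  by_contra hc
  push Not at hc
  obtain ⟨h0, h1, h2⟩ := hc
  have hp : ∀ i, p i = 0 := by
    intro i
    have := h (q i) (-p i) (by
      ext j
      fin_cases i <;> fin_cases j <;> simp <;> grind)
    simpa using this.2
  have := h 1 0 (by ext j; simp [hp])
  simp at this

lemma lin_ne_zero {p q : Fin 3 → ℂ} (h : Indep p q) : lin p q ≠ 0 := by
  intro h0
  have h1 := lin_eval p q ![1, 0, 0]
  have h2 := lin_eval p q ![0, 1, 0]
  have h3 := lin_eval p q ![0, 0, 1]
  rw [h0] at h1 h2 h3
  simp at h1 h2 h3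
  rcases indep_cross h with h | h | h
  · exact h h1.symm
  · exact h h2.symm
  · exact h h3.symm

/-- A linear form vanishing at two independent vectors is a multiple of `lin`. -/
lemma eq_lin {p q : Fin 3 → ℂ} (h : Indep p q) {l : Poly3} (hl : l.IsHomogeneous 1)
    (h1 : eval p l = 0) (h2 : eval q l = 0) : ∃ c : ℂ, l = C c * lin p q := by
  obtain ⟨a, rfl⟩ := linear_form hl
  simp at h1 h2
  rcases indep_cross h with hc | hc | hc
  · refine ⟨a 0 / (p 1 * q 2 - p 2 * q 1), ?_⟩
    have e1 : a 1 = a 0 / (p 1 * q 2 - p 2 * q 1) * (p 2 * q 0 - p 0 * q 2) := by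
      field_simp; linear_combination q 2 * h1 - p 2 * h2
    have e2 : a 2 = a 0 / (p 1 * q 2 - p 2 * q 1) * (p 0 * q 1 - p 1 * q 0) := by
      field_simp; linear_combination - q 1 * h1 + p 1 * h2
    have e0 : a 0 = a 0 / (p 1 * q 2 - p 2 * q 1) * (p 1 * q 2 - p 2 * q 1) := by
      field_simp
    generalize a 0 / (p 1 * q 2 - p 2 * q 1) = k at e0 e1 e2 ⊢
    rw [e0, e1, e2]
    simp only [lin, C_mul]; ring
  · refine ⟨a 1 / (p 2 * q 0 - p 0 * q 2), ?_⟩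
    have e1 : a 0 = a 1 / (p 2 * q 0 - p 0 * q 2) * (p 1 * q 2 - p 2 * q 1) := by
      field_simp; linear_combination - q 2 * h1 + p 2 * h2
    have e2 : a 2 = a 1 / (p 2 * q 0 - p 0 * q 2) * (p 0 * q 1 - p 1 * q 0) := by
      field_simp; linear_combination q 0 * h1 - p 0 * h2
    have e0 : a 1 = a 1 / (p 2 * q 0 - p 0 * q 2) * (p 2 * q 0 - p 0 * q 2) := by
      field_simp
    generalize a 1 / (p 2 * q 0 - p 0 * q 2) = k at e0 e1 e2 ⊢
    rw [e0, e1, e2]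
    simp only [lin, C_mul]; ring
  · refine ⟨a 2 / (p 0 * q 1 - p 1 * q 0), ?_⟩
    have e1 : a 0 = a 2 / (p 0 * q 1 - p 1 * q 0) * (p 1 * q 2 - p 2 * q 1) := by
      field_simp; linear_combination q 1 * h1 - p 1 * h2
    have e2 : a 1 = a 2 / (p 0 * q 1 - p 1 * q 0) * (p 2 * q 0 - p 0 * q 2) := by
      field_simp; linear_combination - q 0 * h1 + p 0 * h2
    have e0 : a 2 = a 2 / (p 0 * q 1 - p 1 * q 0) * (p 0 * q 1 - p 1 * q 0) := by
      field_simp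
    generalize a 2 / (p 0 * q 1 - p 1 * q 0) = k at e0 e1 e2 ⊢
    rw [e0, e1, e2]
    simp only [lin, C_mul]; ring

/-- A zero of `lin p q` is in the span of `p, q`. -/
lemma lin_zero {p q x : Fin 3 → ℂ} (h : Indep p q) (hx : eval x (lin p q) = 0) :
    ∃ s t : ℂ, x = s • p + t • q := by
  rw [lin_eval] at hx
  rcases indep_cross h with hc | hc | hc
  · have hd := mul_inv_cancel₀ hc
    generalize (p 1 * q 2 - p 2 * q 1)⁻¹ = e at hd
    refine ⟨(x 1 * q 2 - x 2 * q 1) * e, (p 1 * x 2 - p 2 * x 1) * e, ?_⟩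
    have g0 : x 0 = (x 1 * q 2 - x 2 * q 1) * e * p 0 + (p 1 * x 2 - p 2 * x 1) * e * q 0 := by
      linear_combination e * hx - x 0 * hd
    have g1 : x 1 = (x 1 * q 2 - x 2 * q 1) * e * p 1 + (p 1 * x 2 - p 2 * x 1) * e * q 1 := by
      linear_combination - x 1 * hd
    have g2 : x 2 = (x 1 * q 2 - x 2 * q 1) * e * p 2 + (p 1 * x 2 - p 2 * x 1) * e * q 2 := by
      linear_combination - x 2 * hd
    ext i; fin_cases i
    · exact g0
    · exact g1
    · exact g2
  · have hd := mul_inv_cancel₀ hc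
    generalize (p 2 * q 0 - p 0 * q 2)⁻¹ = e at hd
    refine ⟨(x 2 * q 0 - x 0 * q 2) * e, (p 2 * x 0 - p 0 * x 2) * e, ?_⟩
    have g1 : x 1 = (x 2 * q 0 - x 0 * q 2) * e * p 1 + (p 2 * x 0 - p 0 * x 2) * e * q 1 := by
      linear_combination e * hx - x 1 * hd
    have g2 : x 2 = (x 2 * q 0 - x 0 * q 2) * e * p 2 + (p 2 * x 0 - p 0 * x 2) * e * q 2 := by
      linear_combination - x 2 * hd
    have g0 : x 0 = (x 2 * q 0 - x 0 * q 2) * e * p 0 + (p 2 * x 0 - p 0 * x 2) * e * q 0 := by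
      linear_combination - x 0 * hd
    ext i; fin_cases i
    · exact g0
    · exact g1
    · exact g2
  · have hd := mul_inv_cancel₀ hc
    generalize (p 0 * q 1 - p 1 * q 0)⁻¹ = e at hd
    refine ⟨(x 0 * q 1 - x 1 * q 0) * e, (p 0 * x 1 - p 1 * x 0) * e, ?_⟩
    have g2 : x 2 = (x 0 * q 1 - x 1 * q 0) * e * p 2 + (p 0 * x 1 - p 1 * x 0) * e * q 2 := by
      linear_combination e * hx - x 2 * hd
    have g0 : x 0 = (x 0 * q 1 - x 1 * q 0) * e * p 0 + (p 0 * x 1 - p 1 * x 0) * e * q 0 := by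
      linear_combination - x 0 * hd
    have g1 : x 1 = (x 0 * q 1 - x 1 * q 0) * e * p 1 + (p 0 * x 1 - p 1 * x 0) * e * q 1 := by
      linear_combination - x 1 * hd
    ext i; fin_cases i
    · exact g0
    · exact g1
    · exact g2

lemma lin_dvd {p q : Fin 3 → ℂ} (h : Indep p q) {F : Poly3}
    (hF : ∀ s t : ℂ, eval (s • p + t • q) F = 0) : lin p q ∣ F := by
  have hp : Prime (lin p q) := (linear_irreducible (lin_homog p q) (lin_ne_zero h)).prime
  have hI : (Ideal.span {lin p q}).IsPrime := (Ideal.span_singleton_prime (lin_ne_zero h)).mpr hp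
  have := IsPrime.vanishingIdeal_zeroLocus (K := ℂ) (Ideal.span {lin p q})
  rw [← Ideal.mem_span_singleton, ← this, mem_vanishingIdeal_iff]
  intro x hx
  rw [mem_zeroLocus_iff] at hx
  have h1 := hx _ (Ideal.mem_span_singleton_self _)
  rw [aeval_eq_eval] at h1 ⊢
  obtain ⟨s, t, rfl⟩ := lin_zero h (by simpa using h1)
  simpa using hF s t

lemma euler_eval {F : Poly3} {d : ℕ} (hF : F.IsHomogeneous d) (x : Fin 3 → ℂ) :
    (d : ℂ) * eval x F = ∑ i, x i * eval x (pderiv i F) := by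
  have := congrArg (eval x) hF.sum_X_mul_pderiv
  simpa using this.symm

/-- restriction of forms to a line -/
lemma restr0 {F : Poly3} (hF : F.IsHomogeneous 0) (p q : Fin 3 → ℂ) :
    ∃ a : ℂ, ∀ s t : ℂ, eval (s • p + t • q) F = a := by
  obtain ⟨c, rfl⟩ := const_of_homog_zero hF
  exact ⟨c, by simp⟩

lemma restr1 {F : Poly3} (hF : F.IsHomogeneous 1) (p q : Fin 3 → ℂ) :
    ∃ a b : ℂ, ∀ s t : ℂ, eval (s • p + t • q) F = a * s + b * t := by
  choose a ha using fun i => restr0 (hF.pderiv (i := i)) p q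
  refine ⟨∑ i, p i * a i, ∑ i, q i * a i, fun s t => ?_⟩
  have := euler_eval hF (s • p + t • q)
  simp only [ha] at this
  simp [Fin.sum_univ_three] at this ⊢
  rw [this]; ring

lemma restr2 {F : Poly3} (hF : F.IsHomogeneous 2) (p q : Fin 3 → ℂ) :
    ∃ a b c : ℂ, ∀ s t : ℂ, eval (s • p + t • q) F = a * s ^ 2 + b * s * t + c * t ^ 2 := by
  choose a b ha using fun i => restr1 (hF.pderiv (i := i)) p q
  refine ⟨(∑ i, p i * a i) / 2, (∑ i, (q i * a i + p i * b i)) / 2,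
    (∑ i, q i * b i) / 2, fun s t => ?_⟩
  have := euler_eval hF (s • p + t • q)
  simp only [ha] at this
  simp [Fin.sum_univ_three] at this ⊢
  linear_combination this / 2

lemma restr3 {F : Poly3} (hF : F.IsHomogeneous 3) (p q : Fin 3 → ℂ) :
    ∃ a b c d : ℂ, ∀ s t : ℂ, eval (s • p + t • q) F =
      a * s ^ 3 + b * s ^ 2 * t + c * s * t ^ 2 + d * t ^ 3 := by
  choose a b c ha using fun i => restr2 (hF.pderiv (i := i)) p q
  refine ⟨(∑ i, p i * a i) / 3, (∑ i, (q i * a i + p i * b i)) / 3,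
    (∑ i, (q i * b i + p i * c i)) / 3,
    (∑ i, q i * c i) / 3, fun s t => ?_⟩
  have := euler_eval hF (s • p + t • q)
  simp only [ha] at this
  simp [Fin.sum_univ_three] at this ⊢
  linear_combination this / 3

/-- A conic through three collinear points contains the line. -/
lemma conic_line {F : Poly3} (hF : F.IsHomogeneous 2) {p q : Fin 3 → ℂ} (h : Indep p q)
    (hp : eval p F = 0) (hq : eval q F = 0) {s t : ℂ} (hs : s ≠ 0) (ht : t ≠ 0)
    (hr : eval (s • p + t • q) F = 0) : lin p q ∣ F := by
  obtain ⟨a, b, c, habc⟩ := restr2 hF p q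
  have h1 := habc 1 0
  have h2 := habc 0 1
  simp [hp, hq] at h1 h2
  rw [habc, ← h1, ← h2] at hr
  have hb : b = 0 := by simpa [hs, ht] using hr
  exact lin_dvd h fun s t => by rw [habc, ← h1, ← h2, hb]; ring

/-- Directional derivative along a line. -/
lemma deriv_line (F : Poly3) (p q : Fin 3 → ℂ) :
    HasDerivAt (fun t : ℂ => eval ((1 : ℂ) • p + t • q) F) (∑ i, q i * eval p (pderiv i F)) 0 := by
  induction F using MvPolynomial.induction_on with
  | C a => simpa using hasDerivAt_const (0 : ℂ) a
  | add f g hf hg =>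
    simp only [map_add, mul_add, Finset.sum_add_distrib]
    exact hf.add hg
  | mul_X f i hf =>
    have h1 : HasDerivAt (fun t : ℂ => eval ((1 : ℂ) • p + t • q) (X i : Poly3)) (q i) 0 := by
      simp only [eval_X, Pi.add_apply, Pi.smul_apply, smul_eq_mul, one_mul]
      simpa using ((hasDerivAt_id (0 : ℂ)).mul_const (q i)).const_add (p i)
    have := hf.mul h1
    simp only [map_mul]
    refine HasDerivAt.congr_deriv this ?_
    have h2 : ∀ j, q j * eval p (pderiv j (f * X i)) =
        (q j * eval p (pderiv j f)) * p i + eval p f * (if j = i then q j else 0) := by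
      intro j
      rw [Derivation.leibniz, pderiv_X]
      by_cases hj : j = i
      · subst hj; simp; ring
      · simp [hj, Ne.symm hj]; ring
    rw [Finset.sum_congr rfl fun j _ => h2 j, Finset.sum_add_distrib, ← Finset.sum_mul,
      ← Finset.mul_sum]
    simp

/-- A cubic singular at `p` and passing through `q` and `p + q` contains the line. -/
lemma cubic_line {F : Poly3} (hF : F.IsHomogeneous 3) {p q : Fin 3 → ℂ} (h : Indep p q)
    (hp : eval p F = 0) (hp' : ∀ i, eval p (pderiv i F) = 0) (hq : eval q F = 0)
    (hr : eval (p + q) F = 0) : lin p q ∣ F := by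
  obtain ⟨a, b, c, d, habc⟩ := restr3 hF p q
  have h1 := habc 1 0
  have h2 := habc 0 1
  have h3 := habc 1 1
  have h4 := deriv_line F p q
  simp only [habc, hp', mul_zero, Finset.sum_const_zero] at h4
  have h5 : HasDerivAt (fun t : ℂ => a * 1 ^ 3 + b * 1 ^ 2 * t + c * 1 * t ^ 2 + d * t ^ 3) b 0 := by
    have e1 := ((hasDerivAt_id (0 : ℂ)).const_mul (b * 1 ^ 2)).const_add (a * 1 ^ 3)
    have e2 := ((hasDerivAt_id (0 : ℂ)).pow 2).const_mul (c * 1)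
    have e3 := ((hasDerivAt_id (0 : ℂ)).pow 3).const_mul d
    have := (e1.add e2).add e3
    refine HasDerivAt.congr_deriv this ?_
    simp
  have hb := h4.unique h5
  simp [hp, hq, hr] at h1 h2 h3
  rw [← h1, ← h2, ← hb] at h3
  have hc : c = 0 := by simpa using h3.symm
  exact lin_dvd h fun s t => by rw [habc, ← h1, ← h2, ← hb, hc]; ring

lemma indep_rep {P Q : P2C} (h : P ≠ Q) : Indep P.rep Q.rep := by
  have h1 := (Projectivization.independent_pair_iff_ne P Q).mpr h
  rw [Projectivization.independent_iff] at h1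
  have h3 : (Projectivization.rep ∘ ![P, Q]) = ![P.rep, Q.rep] := by
    ext i; fin_cases i <;> rfl
  rw [h3] at h1
  have h2 : LinearIndependent ℂ ![P.rep, Q.rep] := h1
  intro s t hst
  exact LinearIndependent.pair_iff.mp h2 s t hst

def FIndep (f f' : Poly3) : Prop := ∀ α β : ℂ, C α * f + C β * f' = 0 → α = 0 ∧ β = 0

lemma FIndep.of_mul {l f f' : Poly3} (h : FIndep (l * f) (l * f')) : FIndep f f' := by
  intro α β hαβ
  apply h
  linear_combination l * hαβ

lemma pencil_pt {f f' : Poly3} (h : FIndep f f') (x : Fin 3 → ℂ) :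
    ∃ α β : ℂ, C α * f + C β * f' ≠ 0 ∧ eval x (C α * f + C β * f') = 0 := by
  by_cases h0 : eval x f = 0
  · refine ⟨1, 0, fun hc => ?_, by simp [h0]⟩
    simpa using (h _ _ hc).1
  · refine ⟨eval x f', - eval x f, fun hc => h0 ?_, ?_⟩
    · simpa using (h _ _ hc).2
    · simp; ring

lemma lin_self_left (p q : Fin 3 → ℂ) : eval p (lin p q) = 0 := by rw [lin_eval]; ring
lemma lin_self_right (p q : Fin 3 → ℂ) : eval q (lin p q) = 0 := by rw [lin_eval]; ring

lemma rep_on_line {P Q R : P2C} (hPQ : P ≠ Q) (hPR : P ≠ R) (hQR : Q ≠ R)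
    (h : eval R.rep (lin P.rep Q.rep) = 0) :
    ∃ s t : ℂ, s ≠ 0 ∧ t ≠ 0 ∧ R.rep = s • P.rep + t • Q.rep := by
  obtain ⟨s, t, hst⟩ := lin_zero (indep_rep hPQ) h
  refine ⟨s, t, ?_, ?_, hst⟩
  · rintro rfl
    have := (indep_rep hQR) t (-1) (by rw [hst]; simp)
    simp at this
  · rintro rfl
    have := (indep_rep hPR) s (-1) (by rw [hst]; simp)
    simp at this

open Classical in
lemma card_cover (S : Finset P2C) (F a b : Poly3) (hF : F = a * b)
    (h : ∀ P ∈ S, eval P.rep F = 0) :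
    S.card ≤ (S.filter fun P => eval P.rep a = 0).card + (S.filter fun P => eval P.rep b = 0).card := by
  refine le_trans (Finset.card_le_card ?_) (Finset.card_union_le _ _)
  intro P hP
  have := h P hP
  rw [hF, map_mul, mul_eq_zero] at this
  simp only [Finset.mem_union, Finset.mem_filter]
  tauto

open Classical in
lemma conic_pencil (S : Finset P2C) (h5 : 5 ≤ S.card)
    (hl : ∀ l : Poly3, l ≠ 0 → l.IsHomogeneous 1 → (S.filter fun P => eval P.rep l = 0).card ≤ 3)
    (q q' : Poly3) (hq : q.IsHomogeneous 2) (hq' : q'.IsHomogeneous 2) (hi : FIndep q q')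
    (hv : ∀ P ∈ S, eval P.rep q = 0) (hv' : ∀ P ∈ S, eval P.rep q' = 0) : False := by
  -- there is a line with three points
  have h1 : ∃ m : Poly3, m ≠ 0 ∧ m.IsHomogeneous 1 ∧
      3 ≤ (S.filter fun P => eval P.rep m = 0).card := by
    obtain ⟨P, hP, Q, hQ, hPQ⟩ := Finset.one_lt_card.mp (show 1 < S.card by omega)
    obtain ⟨α, β, hne, hz⟩ := pencil_pt hi (P.rep + Q.rep)
    have hh : (C α * q + C β * q').IsHomogeneous 2 := (hq.C_mul α).add (hq'.C_mul β)
    have hvan : ∀ R ∈ S, eval R.rep (C α * q + C β * q') = 0 := by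
      intro R hR; simp [hv R hR, hv' R hR]
    obtain ⟨M, hM⟩ := conic_line hh (indep_rep hPQ) (hvan P hP) (hvan Q hQ)
      (one_ne_zero) (one_ne_zero) (by simpa using hz)
    have hM1 : M.IsHomogeneous 1 :=
      homog_of_mul (lin_homog _ _) (lin_ne_zero (indep_rep hPQ)) (by rw [← hM]; exact hh)
    have hc := card_cover S _ _ _ hM hvan
    by_cases h3 : 3 ≤ (S.filter fun R => eval R.rep (lin P.rep Q.rep) = 0).card
    · exact ⟨_, lin_ne_zero (indep_rep hPQ), lin_homog _ _, h3⟩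
    · refine ⟨M, ?_, hM1, by omega⟩
      rintro rfl
      simp [hM] at hne
  obtain ⟨m, hm0, hm1, hm3⟩ := h1
  obtain ⟨P, hP, Q, hQ, R, hR, hPQ, hPR, hQR⟩ := Finset.two_lt_card.mp hm3
  simp only [Finset.mem_filter] at hP hQ hR
  obtain ⟨c, hc⟩ := eq_lin (indep_rep hPQ) hm1 hP.2 hQ.2
  have hc0 : c ≠ 0 := by rintro rfl; simp [hc] at hm0
  have hRL : eval R.rep (lin P.rep Q.rep) = 0 := by
    have := hR.2
    rw [hc, map_mul, eval_C] at this
    simpa [hc0] using this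
  obtain ⟨s, t, hs, ht, hst⟩ := rep_on_line hPQ hPR hQR hRL
  obtain ⟨a, ha⟩ := conic_line hq (indep_rep hPQ) (hv P hP.1) (hv Q hQ.1) hs ht
    (by rw [← hst]; exact hv R hR.1)
  obtain ⟨a', ha'⟩ := conic_line hq' (indep_rep hPQ) (hv' P hP.1) (hv' Q hQ.1) hs ht
    (by rw [← hst]; exact hv' R hR.1)
  have hL0 := lin_ne_zero (indep_rep hPQ)
  have ha1 : a.IsHomogeneous 1 := homog_of_mul (lin_homog _ _) hL0 (by rw [← ha]; exact hq)
  have ha1' : a'.IsHomogeneous 1 := homog_of_mul (lin_homog _ _) hL0 (by rw [← ha']; exact hq')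
  have hi2 : FIndep a a' := by
    apply FIndep.of_mul (l := lin P.rep Q.rep); rwa [← ha, ← ha']
  have hsum := Finset.card_filter_add_card_filter_not (s := S)
    (fun P' => eval P'.rep (lin P.rep Q.rep) = 0)
  have hl3 := hl _ hL0 (lin_homog _ _)
  obtain ⟨U, hU, V, hV, hUV⟩ := Finset.one_lt_card.mp
    (show 1 < (S.filter fun P' => ¬ eval P'.rep (lin P.rep Q.rep) = 0).card by omega)
  simp only [Finset.mem_filter] at hU hV
  have key : ∀ b F : Poly3, F = lin P.rep Q.rep * b → ∀ W : P2C, eval W.rep F = 0 →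
      ¬ eval W.rep (lin P.rep Q.rep) = 0 → eval W.rep b = 0 := by
    intro b F hF W hW hW'
    rw [hF, map_mul, mul_eq_zero] at hW
    tauto
  obtain ⟨c1, hc1⟩ := eq_lin (indep_rep hUV) ha1 (key a q ha U (hv U hU.1) hU.2)
    (key a q ha V (hv V hV.1) hV.2)
  obtain ⟨c2, hc2⟩ := eq_lin (indep_rep hUV) ha1' (key a' q' ha' U (hv' U hU.1) hU.2)
    (key a' q' ha' V (hv' V hV.1) hV.2)
  have h0 := hi2 c2 (-c1) (by rw [hc1, hc2, map_neg]; ring)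
  have h00 := hi2 1 0 (by
    have : c1 = 0 := by simpa using h0.2
    rw [hc1, this]; simp)
  simp at h00

open Classical in
/-- No common linear factor. -/
lemma no_common_line (S : Finset P2C) (h8 : S.card = 8)
    (hl : ∀ l : Poly3, l ≠ 0 → l.IsHomogeneous 1 → (S.filter fun P => eval P.rep l = 0).card ≤ 3)
    (f f' : Poly3) (hf : f.IsHomogeneous 3) (hf' : f'.IsHomogeneous 3) (hi : FIndep f f')
    (hv : ∀ P ∈ S, eval P.rep f = 0) (hv' : ∀ P ∈ S, eval P.rep f' = 0)
    (l : Poly3) (hl0 : l ≠ 0) (hl1 : l.IsHomogeneous 1) (hd : l ∣ f) (hd' : l ∣ f') : False := by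
  obtain ⟨q, rfl⟩ := hd
  obtain ⟨q', rfl⟩ := hd'
  have hq : q.IsHomogeneous 2 := homog_of_mul hl1 hl0 hf
  have hq' : q'.IsHomogeneous 2 := homog_of_mul hl1 hl0 hf'
  have hsum := Finset.card_filter_add_card_filter_not (s := S) (fun P' => eval P'.rep l = 0)
  have hl3 := hl _ hl0 hl1
  refine conic_pencil (S.filter fun P => ¬ eval P.rep l = 0) (by omega) ?_ q q' hq hq' hi.of_mul ?_ ?_
  · intro m hm0 hm1
    refine le_trans (Finset.card_le_card ?_) (hl m hm0 hm1)
    exact Finset.filter_subset_filter _ (Finset.filter_subset _ _)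
  · intro P hP
    rw [Finset.mem_filter] at hP
    have := hv P hP.1
    rw [map_mul, mul_eq_zero] at this
    tauto
  · intro P hP
    rw [Finset.mem_filter] at hP
    have := hv' P hP.1
    rw [map_mul, mul_eq_zero] at this
    tauto

lemma lin_eval_swap (p q x : Fin 3 → ℂ) : eval q (lin p x) = - eval x (lin p q) := by
  rw [lin_eval, lin_eval]; ring

open Classical in
/-- The pencil is not everywhere singular at a point of `S`. -/
lemma no_common_sing (S : Finset P2C) (h8 : S.card = 8)
    (hl : ∀ l : Poly3, l ≠ 0 → l.IsHomogeneous 1 → (S.filter fun P => eval P.rep l = 0).card ≤ 3)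
    (hq : ∀ l : Poly3, l ≠ 0 → l.IsHomogeneous 2 → (S.filter fun P => eval P.rep l = 0).card ≤ 6)
    (f f' : Poly3) (hf : f.IsHomogeneous 3) (hf' : f'.IsHomogeneous 3) (hi : FIndep f f')
    (hv : ∀ P ∈ S, eval P.rep f = 0) (hv' : ∀ P ∈ S, eval P.rep f' = 0)
    (P : P2C) (hP : P ∈ S) (hs : ∀ i, eval P.rep (pderiv i f) = 0)
    (hs' : ∀ i, eval P.rep (pderiv i f') = 0) : False := by
  have h1 : ∀ Q ∈ S, Q ≠ P → 3 ≤ (S.filter fun R => eval R.rep (lin P.rep Q.rep) = 0).card := by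
    intro Q hQ hQP
    have hin := indep_rep (Ne.symm hQP)
    obtain ⟨α, β, hne, hz⟩ := pencil_pt hi (P.rep + Q.rep)
    have hh : (C α * f + C β * f').IsHomogeneous 3 := (hf.C_mul α).add (hf'.C_mul β)
    have hvan : ∀ R ∈ S, eval R.rep (C α * f + C β * f') = 0 := by
      intro R hR; simp [hv R hR, hv' R hR]
    have hsing : ∀ i, eval P.rep (pderiv i (C α * f + C β * f')) = 0 := by
      intro i; simp [hs i, hs' i]
    obtain ⟨M, hM⟩ := cubic_line hh hin (hvan P hP) hsing (hvan Q hQ) hz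
    have hL0 := lin_ne_zero hin
    have hM2 : M.IsHomogeneous 2 := homog_of_mul (lin_homog _ _) hL0 (by rw [← hM]; exact hh)
    have hM0 : M ≠ 0 := by rintro rfl; simp [hM] at hne
    have hMP : eval P.rep M = 0 := by
      have h3 : ∀ i, eval P.rep (pderiv i (lin P.rep Q.rep)) * eval P.rep M = 0 := by
        intro i
        have := hsing i
        rw [hM, Derivation.leibniz] at this
        simp only [smul_eq_mul, map_add, map_mul, lin_self_left, zero_mul, zero_add] at this
        rw [mul_comm]; exact this
      by_contra hMP
      have h4 := euler_eval (lin_homog P.rep Q.rep)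
      have e0 := h3 0
      have e1 := h3 1
      have e2 := h3 2
      simp [lin, hMP, pderiv_X] at e0 e1 e2
      rcases indep_cross hin with h | h | h
      · exact h e0
      · exact h e1
      · exact h e2
    have h6 := hq M hM0 hM2
    have hcov : S.card + 1 ≤ (S.filter fun R => eval R.rep (lin P.rep Q.rep) = 0).card +
        (S.filter fun R => eval R.rep M = 0).card := by
      rw [← Finset.card_union_add_card_inter]
      apply add_le_add
      · apply Finset.card_le_card
        intro R hR
        have := hvan R hR
        rw [hM, map_mul, mul_eq_zero] at this
        simp only [Finset.mem_union, Finset.mem_filter]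
        tauto
      · apply Finset.card_pos.mpr
        exact ⟨P, by simp [hP, hMP, lin_self_left]⟩
    omega
  -- the third point
  have h2 : ∀ Q ∈ S.erase P, ∃ R ∈ S.erase P, R ≠ Q ∧ eval R.rep (lin P.rep Q.rep) = 0 := by
    intro Q hQ
    rw [Finset.mem_erase] at hQ
    have h3 := h1 Q hQ.2 hQ.1
    have : 0 < (((S.filter fun R => eval R.rep (lin P.rep Q.rep) = 0).erase P).erase Q).card := by
      have a1 := Finset.pred_card_le_card_erase
        (s := S.filter fun R => eval R.rep (lin P.rep Q.rep) = 0) (a := P)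
      have a2 := Finset.pred_card_le_card_erase
        (s := (S.filter fun R => eval R.rep (lin P.rep Q.rep) = 0).erase P) (a := Q)
      omega
    obtain ⟨R, hR⟩ := Finset.card_pos.mp this
    simp only [Finset.mem_erase, Finset.mem_filter] at hR
    exact ⟨R, by simp [hR], hR.1, hR.2.2.2⟩
  choose! σ hσ1 hσ2 hσ3 using h2
  have h3 : ∑ Q ∈ S.erase P, (1 : ZMod 2) = 0 := by
    refine Finset.sum_involution (fun Q _ => σ Q) ?_ ?_ ?_ ?_
    · intro Q hQ; decide
    · intro Q hQ _; exact hσ2 Q hQ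
    · intro Q hQ; exact hσ1 Q hQ
    · intro Q hQ
      by_contra hne
      have hR := hσ1 Q hQ
      have hU := hσ1 _ hR
      have hn1 := hσ2 Q hQ
      have hn2 := hσ2 _ hR
      have hz1 := hσ3 Q hQ
      have hz2 := hσ3 _ hR
      rw [Finset.mem_erase] at hQ hR hU
      have hin := indep_rep (Ne.symm hR.1)
      have hsub : ({P, Q, σ Q, σ (σ Q)} : Finset P2C) ⊆
          S.filter fun R' => eval R'.rep (lin P.rep (σ Q).rep) = 0 := by
        intro W hW
        simp only [Finset.mem_insert, Finset.mem_singleton] at hW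
        rw [Finset.mem_filter]
        rcases hW with rfl | rfl | rfl | rfl
        · exact ⟨hP, lin_self_left _ _⟩
        · exact ⟨hQ.2, by rw [lin_eval_swap, hz1, neg_zero]⟩
        · exact ⟨hR.2, lin_self_right _ _⟩
        · exact ⟨hU.2, hz2⟩
      have hcard := Finset.card_le_card hsub
      have hle := hl _ (lin_ne_zero hin) (lin_homog P.rep (σ Q).rep)
      have h4 : ({P, Q, σ Q, σ (σ Q)} : Finset P2C).card = 4 := by
        rw [Finset.card_insert_of_notMem, Finset.card_insert_of_notMem,
          Finset.card_insert_of_notMem, Finset.card_singleton]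
        · simpa using Ne.symm hn2
        · simp only [Finset.mem_insert, Finset.mem_singleton, not_or]
          exact ⟨Ne.symm hn1, Ne.symm hne⟩
        · simp only [Finset.mem_insert, Finset.mem_singleton, not_or]
          exact ⟨Ne.symm hQ.1, Ne.symm hR.1, Ne.symm hU.1⟩
      omega
  rw [Finset.sum_const, Finset.card_erase_of_mem hP, h8] at h3
  revert h3
  decide

open Classical in
/-- Only finitely many members of the pencil have a linear factor. -/
lemma finite_reducible (S : Finset P2C) (h8 : S.card = 8)
    (hl : ∀ l : Poly3, l ≠ 0 → l.IsHomogeneous 1 → (S.filter fun P => eval P.rep l = 0).card ≤ 3)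
    (hq : ∀ l : Poly3, l ≠ 0 → l.IsHomogeneous 2 → (S.filter fun P => eval P.rep l = 0).card ≤ 6)
    (f f' : Poly3) (hf : f.IsHomogeneous 3) (hf' : f'.IsHomogeneous 3) (hi : FIndep f f')
    (hv : ∀ P ∈ S, eval P.rep f = 0) (hv' : ∀ P ∈ S, eval P.rep f' = 0) :
    {t : ℂ | ¬ Irreducible (f - C t * f')}.Finite := by
  have h0 : ∀ t : ℂ, f - C t * f' ≠ 0 := by
    intro t ht
    have := (hi 1 (-t) (by rw [map_neg, map_one]; linear_combination ht)).1
    simp at this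
  have h1 : ∀ t ∈ {t : ℂ | ¬ Irreducible (f - C t * f')}, ∃ PQ : P2C × P2C,
      PQ ∈ S ×ˢ S ∧ PQ.1 ≠ PQ.2 ∧ lin PQ.1.rep PQ.2.rep ∣ f - C t * f' := by
    intro t ht
    have : ∃ l q : Poly3, l.IsHomogeneous 1 ∧ q.IsHomogeneous 2 ∧ f - C t * f' = l * q := by
      by_contra hc
      push Not at hc
      exact ht (cubic_irreducible (hf.sub (hf'.C_mul t)) (h0 t) hc)
    obtain ⟨l, q, hl1, hq2, hlq⟩ := this
    have hl0 : l ≠ 0 := by rintro rfl; exact h0 t (by simpa using hlq)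
    have hq0 : q ≠ 0 := by rintro rfl; exact h0 t (by simpa using hlq)
    have hcov := card_cover S _ _ _ hlq (by intro P hP; simp [hv P hP, hv' P hP])
    have := hq q hq0 hq2
    obtain ⟨P, hP, Q, hQ, hPQ⟩ := Finset.one_lt_card.mp
      (show 1 < (S.filter fun P' => eval P'.rep l = 0).card by omega)
    rw [Finset.mem_filter] at hP hQ
    refine ⟨(P, Q), by simp [hP.1, hQ.1], hPQ, ?_⟩
    obtain ⟨c, hc⟩ := eq_lin (indep_rep hPQ) hl1 hP.2 hQ.2
    have hc0 : c ≠ 0 := by rintro rfl; simp [hc] at hl0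
    refine ⟨C c * q, ?_⟩
    rw [hlq, hc]; ring
  choose! φ hφ1 hφ2 hφ3 using h1
  refine Set.Finite.of_finite_image (f := φ) ((S ×ˢ S).finite_toSet.subset ?_) ?_
  · rintro _ ⟨t, ht, rfl⟩
    exact hφ1 t ht
  · intro t ht s hs hts
    by_contra hne
    have d1 := hφ3 t ht
    have d2 := hφ3 s hs
    rw [← hts] at d2
    have hf2 : lin (φ t).1.rep (φ t).2.rep ∣ f' := by
      have := dvd_sub d2 d1
      have e : f - C s * f' - (f - C t * f') = C (t - s) * f' := by rw [map_sub]; ring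
      rw [e] at this
      have hu : IsUnit (C (t - s) : Poly3) := (IsUnit.mk0 _ (sub_ne_zero.mpr hne)).map C
      exact hu.dvd_mul_left.mp this
    have hf1 : lin (φ t).1.rep (φ t).2.rep ∣ f := by
      have := dvd_add d1 (hf2.mul_left (C t))
      rwa [sub_add_cancel] at this
    exact no_common_line S h8 hl f f' hf hf' hi hv hv' _ (lin_ne_zero (indep_rep (hφ2 t ht)))
      (lin_homog _ _) hf1 hf2

open Classical in
/-- Only finitely many members of the pencil are singular at some point of `S`. -/
lemma finite_singular (S : Finset P2C) (h8 : S.card = 8)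
    (hl : ∀ l : Poly3, l ≠ 0 → l.IsHomogeneous 1 → (S.filter fun P => eval P.rep l = 0).card ≤ 3)
    (hq : ∀ l : Poly3, l ≠ 0 → l.IsHomogeneous 2 → (S.filter fun P => eval P.rep l = 0).card ≤ 6)
    (f f' : Poly3) (hf : f.IsHomogeneous 3) (hf' : f'.IsHomogeneous 3) (hi : FIndep f f')
    (hv : ∀ P ∈ S, eval P.rep f = 0) (hv' : ∀ P ∈ S, eval P.rep f' = 0) :
    {t : ℂ | ∃ P ∈ S, ∀ i, eval P.rep (pderiv i (f - C t * f')) = 0}.Finite := by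
  have h1 : ∀ t ∈ {t : ℂ | ∃ P ∈ S, ∀ i, eval P.rep (pderiv i (f - C t * f')) = 0},
    ∃ P ∈ S, ∀ i, eval P.rep (pderiv i (f - C t * f')) = 0 := fun t ht => ht
  choose! φ hφ1 hφ2 using h1
  refine Set.Finite.of_finite_image (f := φ) (S.finite_toSet.subset ?_) ?_
  · rintro _ ⟨t, ht, rfl⟩
    exact hφ1 t ht
  · intro t ht s hs hts
    by_contra hne
    have d1 := hφ2 t ht
    have d2 := hφ2 s hs
    rw [← hts] at d2
    have hne' : t - s ≠ 0 := sub_ne_zero.mpr hne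
    have e2 : ∀ i, eval (φ t).rep (pderiv i f') = 0 := by
      intro i
      have a1 := d1 i
      have a2 := d2 i
      simp at a1 a2
      have : (t - s) * eval (φ t).rep (pderiv i f') = 0 := by linear_combination a2 - a1
      simpa [hne'] using this
    have e1 : ∀ i, eval (φ t).rep (pderiv i f) = 0 := by
      intro i
      have a1 := d1 i
      simpa [e2 i] using a1
    exact no_common_sing S h8 hl hq f f' hf hf' hi hv hv' (φ t) (hφ1 t ht) e1 e2

lemma deriv_zero_of_algebraic (B : Subalgebra ℂ Poly3) (D : Derivation ℂ Poly3 Poly3)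
    (hD : ∀ b ∈ B, D b = 0) (x : Poly3) (hx : IsAlgebraic B x) : D x = 0 := by
  let D' : Derivation B Poly3 Poly3 :=
    { toFun := D
      map_add' := map_add D
      map_smul' := by
        intro b y
        rw [Subalgebra.smul_def, smul_eq_mul, Derivation.leibniz, hD _ b.2]
        simp [Subalgebra.smul_def]
      map_one_eq_zero' := D.map_one_eq_zero
      leibniz' := D.leibniz }
  have key : ∀ n, ∀ p : Polynomial B, p ≠ 0 → p.natDegree = n → Polynomial.aeval x p = 0 →
      D' x = 0 := by
    intro n
    induction n with
    | zero =>
      intro p hp hn hz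
      rw [Polynomial.natDegree_eq_zero] at hn
      obtain ⟨b, rfl⟩ := hn
      rw [Polynomial.aeval_C] at hz
      have : b = 0 := Subtype.ext hz
      simp [this] at hp
    | succ n ih =>
      intro p hp hn hz
      have h1 := D'.map_aeval p x
      rw [hz, map_zero, smul_eq_mul] at h1
      rcases mul_eq_zero.mp h1.symm with h | h
      · have hd : (Polynomial.derivative p).natDegree = n := by
          rw [Polynomial.natDegree_derivative, hn]; rfl
        refine ih _ ?_ hd h
        intro h0
        have := Polynomial.derivative_eq_zero.mp h0
        omega
      · exact h
  obtain ⟨p, hp, hz⟩ := hx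
  exact key _ p hp rfl hz

lemma dependent_of_jac (f f' g : Poly3) (h : jacC f f' g = 0) :
    ∃ P : Poly3, P ≠ 0 ∧ aeval ![f, f', g] P = 0 := by
  by_contra hc
  push Not at hc
  have hind : AlgebraicIndependent ℂ ![f, f', g] := by
    rw [algebraicIndependent_iff]
    intro P hP
    by_contra h0
    exact hc P h0 hP
  obtain ⟨v, hv0, hv⟩ := Matrix.exists_mulVec_eq_zero_iff.mpr h
  let D : Derivation ℂ Poly3 Poly3 := mkDerivation ℂ v
  have hDf : ∀ p : Poly3, D p = ∑ i, pderiv i p * v i := by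
    intro p
    have : D = v 0 • pderiv 0 + v 1 • pderiv 1 + v 2 • pderiv 2 := by
      apply MvPolynomial.derivation_ext
      intro i
      fin_cases i <;> simp [D, mkDerivation_X, pderiv_X, Pi.single_apply]
    rw [this, Fin.sum_univ_three]
    simp [mul_comm]
  have hDz : ∀ j, D (![f, f', g] j) = 0 := by
    intro j
    rw [hDf]
    exact congrFun hv j
  have htr : IsTranscendenceBasis ℂ ![f, f', g] := by
    apply hind.isTranscendenceBasis_of_trdeg_le
    · rw [MvPolynomial.trdeg_of_isDomain]; simp
    · rw [MvPolynomial.trdeg_of_isDomain]; simp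
  have halg := htr.isAlgebraic
  apply hv0
  ext1 i
  have := deriv_zero_of_algebraic (Algebra.adjoin ℂ (Set.range ![f, f', g])) D (by
    intro b hb
    induction hb using Algebra.adjoin_induction with
    | mem x hx => obtain ⟨j, rfl⟩ := hx; exact hDz j
    | algebraMap r => exact D.map_algebraMap r
    | add x y _ _ hx hy => rw [map_add, hx, hy, add_zero]
    | mul x y _ _ hx hy => rw [D.leibniz, hx, hy]; simp) (X i) (halg.isAlgebraic _)
  simpa [D] using this

lemma homog_aeval_monomial (v : Fin 3 → Poly3) (w : Fin 3 → ℕ)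
    (hv : ∀ i, (v i).IsHomogeneous (3 * w i)) (s : Fin 3 →₀ ℕ) (c : ℂ) :
    (aeval v (monomial s c)).IsHomogeneous (3 * Finsupp.weight w s) := by
  rw [aeval_monomial, Finsupp.prod_fintype _ _ (by simp), Finsupp.weight_apply,
    Finsupp.sum_fintype _ _ (by simp)]
  have := IsHomogeneous.prod Finset.univ (fun i => v i ^ s i) (fun i => 3 * w i * s i)
    (fun i _ => (hv i).pow (s i))
  have h2 := this.C_mul c
  have e : 3 * ∑ i, s i • w i = ∑ i, 3 * w i * s i := by
    rw [Finset.mul_sum]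
    apply Finset.sum_congr rfl
    intro i _
    simp; ring
  rw [e]
  exact h2

lemma homog_comp_aeval (v : Fin 3 → Poly3) (w : Fin 3 → ℕ)
    (hv : ∀ i, (v i).IsHomogeneous (3 * w i)) (P : Poly3) (n : ℕ) :
    homogeneousComponent (3 * n) (aeval v P) = aeval v (weightedHomogeneousComponent w n P) := by
  induction P using MvPolynomial.induction_on' with
  | monomial s c =>
    rw [homogeneousComponent_of_mem (n := 3 * Finsupp.weight w s) (by
        rw [mem_homogeneousSubmodule]; exact homog_aeval_monomial v w hv s c),
      weightedHomogeneousComponent_of_mem (n := Finsupp.weight w s) (by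
        rw [mem_weightedHomogeneousSubmodule]; exact isWeightedHomogeneous_monomial _ _ _ rfl)]
    by_cases h : n = Finsupp.weight w s
    · subst h; simp
    · rw [if_neg h, if_neg (by omega)]; simp
  | add p q hp hq => simp only [map_add, hp, hq]

lemma whomog_relation (v : Fin 3 → Poly3) (w : Fin 3 → ℕ)
    (hv : ∀ i, (v i).IsHomogeneous (3 * w i)) (P : Poly3) (hP : P ≠ 0) (hz : aeval v P = 0) :
    ∃ (Q : Poly3) (n : ℕ), Q ≠ 0 ∧ IsWeightedHomogeneous w Q n ∧ aeval v Q = 0 := by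
  obtain ⟨s, hs⟩ := MvPolynomial.ne_zero_iff.mp hP
  refine ⟨weightedHomogeneousComponent w (Finsupp.weight w s) P, _, ?_,
    weightedHomogeneousComponent_isWeightedHomogeneous _ _, ?_⟩
  · apply MvPolynomial.ne_zero_iff.mpr
    refine ⟨s, ?_⟩
    classical
    rw [coeff_weightedHomogeneousComponent, if_pos rfl]; exact hs
  · rw [← homog_comp_aeval v w hv, hz, map_zero]

lemma whomog_scale {K : Type*} [Field K] [Algebra ℂ K] (w : Fin 3 → ℕ) (P : Poly3) (n : ℕ)
    (hP : IsWeightedHomogeneous w P n) (u : K) (y : Fin 3 → K) :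
    aeval (fun i => u ^ (w i) * y i) P = u ^ n * aeval y P := by
  rw [aeval_def, aeval_def, eval₂_eq', eval₂_eq', Finset.mul_sum]
  apply Finset.sum_congr rfl
  intro s hs
  have h1 : Finsupp.weight w s = n := hP (mem_support_iff.mp hs)
  rw [Finsupp.weight_apply, Finsupp.sum_fintype _ _ (by simp)] at h1
  simp only [mul_pow, Finset.prod_mul_distrib, ← pow_mul]
  rw [Finset.prod_pow_eq_pow_sum, ← h1]
  have : ∑ i, w i * s i = ∑ i, s i • w i := Finset.sum_congr rfl fun i _ => by simp [mul_comm]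
  rw [this]; ring

def uniP (P : Poly3) : Polynomial (Polynomial ℂ) :=
  aeval ![Polynomial.C Polynomial.X, 1, Polynomial.X] P

lemma uniP_ne_zero (P : Poly3) (n : ℕ) (hP : IsWeightedHomogeneous ![1, 1, 2] P n) (h0 : P ≠ 0) :
    uniP P ≠ 0 := by
  obtain ⟨s, hs⟩ := MvPolynomial.ne_zero_iff.mp h0
  intro hu
  have h1 : ((uniP P).coeff (s 2)).coeff (s 0) = 0 := by rw [hu]; simp
  apply hs
  rw [uniP, aeval_def, eval₂_eq', Polynomial.finsetSum_coeff, Polynomial.finsetSum_coeff] at h1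
  have hterm : ∀ m : Fin 3 →₀ ℕ, ((algebraMap ℂ (Polynomial (Polynomial ℂ)) (coeff m P) *
      ∏ i, (![Polynomial.C Polynomial.X, 1, Polynomial.X] : Fin 3 → Polynomial (Polynomial ℂ)) i ^ m i).coeff (s 2)).coeff (s 0)
      = if s 2 = m 2 ∧ s 0 = m 0 then coeff m P else 0 := by
    intro m
    have e : algebraMap ℂ (Polynomial (Polynomial ℂ)) (coeff m P) *
      ∏ i, (![Polynomial.C Polynomial.X, 1, Polynomial.X] : Fin 3 → Polynomial (Polynomial ℂ)) i ^ m i =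
      Polynomial.C (Polynomial.C (coeff m P) * Polynomial.X ^ (m 0)) * Polynomial.X ^ (m 2) := by
      rw [Fin.prod_univ_three]
      simp only [Matrix.cons_val_zero, Matrix.cons_val_one, Matrix.cons_val, one_pow, mul_one,
        map_mul, map_pow]
      rw [mul_assoc]; rfl
    rw [e, Polynomial.coeff_C_mul_X_pow]
    by_cases h2 : s 2 = m 2
    · rw [if_pos h2, Polynomial.coeff_C_mul_X_pow]; simp [h2]
    · simp [h2]
  rw [Finset.sum_congr rfl fun m _ => hterm m] at h1
  rw [Finset.sum_eq_single s] at h1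
  · simpa using h1
  · intro m hm hne
    rw [if_neg]
    rintro ⟨e2, e0⟩
    apply hne
    have w1 := hP (mem_support_iff.mp hm)
    have w2 := hP hs
    rw [Finsupp.weight_apply, Finsupp.sum_fintype _ _ (by simp), Fin.sum_univ_three] at w1 w2
    simp at w1 w2
    ext i
    fin_cases i
    · exact e0.symm
    · simp; omega
    · exact e2.symm
  · intro hm
    simpa using hm

lemma uniP_map (P : Poly3) (t : ℂ) : (uniP P).map (Polynomial.evalRingHom t) =
    aeval ![Polynomial.C t, 1, Polynomial.X] P := by
  rw [uniP, aeval_def, aeval_def, eval₂_eq', eval₂_eq', Polynomial.map_sum]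
  apply Finset.sum_congr rfl
  intro m _
  simp only [Fin.prod_univ_three, Polynomial.map_mul, Polynomial.map_pow, Matrix.cons_val_zero,
    Matrix.cons_val_one, Matrix.cons_val, Polynomial.map_one, Polynomial.map_X, Polynomial.map_C]
  congr 1
  · simp [Polynomial.algebraMap_apply]
  · simp

lemma exists_field_hom (F : Poly3) (hp : Prime F) :
    ∃ (K : Type) (_ : Field K) (_ : Algebra ℂ K) (φ : Poly3 →ₐ[ℂ] K), ∀ x, φ x = 0 ↔ F ∣ x := by
  have hI : (Ideal.span {F}).IsPrime := (Ideal.span_singleton_prime hp.ne_zero).mpr hp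
  refine ⟨FractionRing (Poly3 ⧸ Ideal.span {F}), inferInstance, inferInstance,
    (IsScalarTower.toAlgHom ℂ (Poly3 ⧸ Ideal.span {F}) _).comp
    (Ideal.Quotient.mkₐ ℂ (Ideal.span {F})), ?_⟩
  intro x
  rw [← Ideal.mem_span_singleton, ← Ideal.Quotient.eq_zero_iff_mem]
  exact (map_eq_zero_iff _ (IsFractionRing.injective (Poly3 ⧸ Ideal.span {F}) _))

lemma dep_const (f f' g P : Poly3) (n : ℕ) (h0 : P ≠ 0)
    (hw : IsWeightedHomogeneous ![1, 1, 2] P n) (hz : aeval ![f, f', g] P = 0) :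
    ∃ B : Set ℂ, B.Finite ∧ ∀ t ∉ B, Prime (f - C t * f') → ¬ (f - C t * f' ∣ f') →
      ∃ c : ℂ, f - C t * f' ∣ g - C c * f' ^ 2 := by
  have hu := uniP_ne_zero P n hw h0
  obtain ⟨k, hk⟩ : ∃ k, (uniP P).coeff k ≠ 0 := by
    by_contra hc
    push Not at hc
    exact hu (Polynomial.ext (by simpa using hc))
  refine ⟨{t | ((uniP P).coeff k).IsRoot t}, Polynomial.finite_setOfPred_isRoot hk, ?_⟩
  intro t ht hp hnd
  set F := f - C t * f' with hF
  have hR : aeval ![Polynomial.C t, 1, Polynomial.X] P ≠ (0 : Polynomial ℂ) := by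
    intro hc
    apply ht
    have := congrArg (fun q => Polynomial.coeff q k) ((uniP_map P t).trans hc)
    simpa [Polynomial.coeff_map] using this
  obtain ⟨K, _, _, φ, hφ⟩ := exists_field_hom F hp
  have hu0 : φ f' ≠ 0 := fun h => hnd ((hφ _).mp h)
  have hff : φ f = algebraMap ℂ K t * φ f' := by
    have h1 : φ F = 0 := (hφ F).mpr dvd_rfl
    rw [hF, map_sub, map_mul, sub_eq_zero] at h1
    rw [h1]
    congr 1
    exact φ.commutes t
  let wv : K := φ g / φ f' ^ 2
  have hg : φ g = φ f' ^ 2 * wv := by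
    simp only [wv]; field_simp
  have h1 : aeval (fun i => φ f' ^ ((![1, 1, 2] : Fin 3 → ℕ) i) * (![algebraMap ℂ K t, 1, wv] : Fin 3 → K) i) P = 0 := by
    have h2 := congrArg φ hz
    rw [map_zero, ← AlgHom.comp_apply, comp_aeval] at h2
    rw [← h2]
    congr 2
    ext i
    fin_cases i
    · simp [hff, mul_comm]
    · simp
    · simp [hg]
  rw [whomog_scale _ P n hw, mul_eq_zero] at h1
  have h2 : aeval ![algebraMap ℂ K t, 1, wv] P = 0 := by
    rcases h1 with h | h
    · exact absurd h (pow_ne_zero n hu0)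
    · exact h
  have h3 : Polynomial.aeval wv (aeval ![Polynomial.C t, 1, Polynomial.X] P : Polynomial ℂ) = 0 := by
    rw [← AlgHom.comp_apply, comp_aeval, ← h2]
    congr 2
    ext i
    fin_cases i <;> simp
  have halg : IsIntegral ℂ wv := (show IsAlgebraic ℂ wv from ⟨_, hR, h3⟩).isIntegral
  obtain ⟨c, hc⟩ : ∃ c, algebraMap ℂ K c = wv := by
    have h4 := minpoly.irreducible halg
    have h5 := IsAlgClosed.degree_eq_one_of_irreducible ℂ h4
    exact minpoly.mem_range_of_degree_eq_one ℂ wv h5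
  refine ⟨c, (hφ _).mp ?_⟩
  rw [map_sub, map_mul, map_pow, hg, ← hc]
  have : φ (C c) = algebraMap ℂ K c := φ.commutes c
  rw [this]; ring

def expo (d : ℕ) (p : {ij : Fin (d+1) × Fin (d+1) // ij.1.val + ij.2.val ≤ d}) : Fin 3 →₀ ℕ :=
  Finsupp.equivFunOnFinite.symm ![p.1.1.val, p.1.2.val, d - (p.1.1.val + p.1.2.val)]

lemma expo_inj (d : ℕ) : Function.Injective (expo d) := by
  rintro ⟨⟨a, b⟩, h⟩ ⟨⟨a', b'⟩, h'⟩ e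
  have e0 := DFunLike.congr_fun e 0
  have e1 := DFunLike.congr_fun e 1
  simp [expo] at e0 e1
  simp [Fin.ext_iff, e0, e1]

lemma expo_homog (d : ℕ) (p) : (monomial (expo d p) (1 : ℂ)).IsHomogeneous d := by
  apply isHomogeneous_monomial
  rw [Finsupp.degree_eq_sum, Fin.sum_univ_three]
  have := p.2
  simp [expo]; omega

instance homog_finite (d : ℕ) : Module.Finite ℂ (homogeneousSubmodule (Fin 3) ℂ d) :=
  Module.Finite.of_fg (homogeneousSubmodule_fg _ _ d)

lemma finrank_homog (d : ℕ) :
    Fintype.card {ij : Fin (d+1) × Fin (d+1) // ij.1.val + ij.2.val ≤ d} ≤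
      Module.finrank ℂ (homogeneousSubmodule (Fin 3) ℂ d) := by
  have h := (basisMonomials (Fin 3) ℂ).linearIndependent.comp _ (expo_inj d)
  have h2 : LinearIndependent ℂ (fun p => (⟨monomial (expo d p) (1 : ℂ), expo_homog d p⟩ :
      homogeneousSubmodule (Fin 3) ℂ d)) := by
    apply LinearIndependent.of_comp (homogeneousSubmodule (Fin 3) ℂ d).subtype
    convert h using 1
    ext1 p
    simp
  exact h2.fintype_card_le_finrank

lemma finrank_cut {ι : Type*} [Fintype ι] (W E : Submodule ℂ Poly3) [Module.Finite ℂ W]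
    [Module.Finite ℂ E] (L : Poly3 →ₗ[ℂ] (ι → ℂ)) (h : ∀ x ∈ W, L x = 0 → x ∈ E) :
    Module.finrank ℂ W ≤ Module.finrank ℂ E + Fintype.card ι := by
  have h1 := LinearMap.finrank_range_add_finrank_ker (L.domRestrict W)
  have h2 : Module.finrank ℂ (LinearMap.range (L.domRestrict W)) ≤ Fintype.card ι := by
    simpa using Submodule.finrank_le (LinearMap.range (L.domRestrict W))
  have h3 : Module.finrank ℂ (LinearMap.ker (L.domRestrict W)) ≤ Module.finrank ℂ E := by
    let j : LinearMap.ker (L.domRestrict W) →ₗ[ℂ] E :=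
      { toFun := fun x => ⟨x.1.1, h _ x.1.2 x.2⟩
        map_add' := fun _ _ => rfl
        map_smul' := fun _ _ => rfl }
    apply LinearMap.finrank_le_finrank_of_injective (f := j)
    intro x y e
    exact Subtype.ext (Subtype.ext (congrArg (fun z : E => z.1) e))
  omega

lemma dim3 (S : Finset P2C) (h8 : S.card = 8) : 2 ≤ Module.finrank ℂ (IsubC 3 (S : Set P2C)) := by
  have : Module.Finite ℂ (IsubC 3 (S : Set P2C)) :=
    Submodule.finiteDimensional_of_le (inf_le_left : _ ≤ homogeneousSubmodule (Fin 3) ℂ 3)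
  have h1 := finrank_cut (ι := S) (homogeneousSubmodule (Fin 3) ℂ 3) (IsubC 3 (S : Set P2C))
    (LinearMap.pi fun P => (aeval P.1.rep : Poly3 →ₐ[ℂ] ℂ).toLinearMap) (by
      intro x hx hL
      refine ⟨hx, ?_⟩
      intro P hP
      have := congrFun hL ⟨P, hP⟩
      simpa [VanishAtC, aeval_eq_eval] using this)
  have h2 := finrank_homog 3
  have h3 : Fintype.card {ij : Fin (3+1) × Fin (3+1) // ij.1.val + ij.2.val ≤ 3} = 10 := by decide
  rw [Fintype.card_coe, h8] at h1
  have h4 := h2.trans h1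
  rw [h3] at h4
  exact Nat.le_of_add_le_add_right (b := 8) h4

lemma dim6 (S : Finset P2C) (h8 : S.card = 8) : 4 ≤ Module.finrank ℂ (Isub2C 6 (S : Set P2C)) := by
  have : Module.Finite ℂ (Isub2C 6 (S : Set P2C)) :=
    Submodule.finiteDimensional_of_le (inf_le_left : _ ≤ homogeneousSubmodule (Fin 3) ℂ 6)
  have h1 := finrank_cut (ι := S × Fin 3) (homogeneousSubmodule (Fin 3) ℂ 6)
    (Isub2C 6 (S : Set P2C))
    (LinearMap.pi fun P => (aeval P.1.1.rep : Poly3 →ₐ[ℂ] ℂ).toLinearMap ∘ₗ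
      (pderiv P.2 : Derivation ℂ Poly3 Poly3).toLinearMap) (by
      intro x hx hL
      refine ⟨hx, ?_⟩
      intro P hP
      have h0 : ∀ i, eval P.rep (pderiv i x) = 0 := by
        intro i
        have := congrFun hL ⟨⟨P, hP⟩, i⟩
        simpa [aeval_eq_eval] using this
      refine ⟨?_, h0⟩
      have := euler_eval (F := x) (d := 6) hx P.rep
      simp only [h0, mul_zero, Finset.sum_const_zero] at this
      simpa using this)
  have h2 := finrank_homog 6
  have h3 : Fintype.card {ij : Fin (6+1) × Fin (6+1) // ij.1.val + ij.2.val ≤ 6} = 28 := by decide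
  rw [Fintype.card_prod, Fintype.card_coe, Fintype.card_fin, h8] at h1
  have h4 := h2.trans h1
  rw [h3] at h4
  exact Nat.le_of_add_le_add_right (b := 24) h4

lemma findep_of_span (S : Finset P2C) (h8 : S.card = 8) (f f' : Poly3)
    (hs : Submodule.span ℂ {f, f'} = IsubC 3 (S : Set P2C)) : FIndep f f' := by
  have h : LinearIndependent ℂ ![f, f'] := by
    rw [linearIndependent_iff_card_le_finrank_span]
    have e : Set.range ![f, f'] = {f, f'} := by simp [Set.pair_comm]
    rw [e, Set.finrank, hs]
    simpa using dim3 S h8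
  intro α β hab
  rw [LinearIndependent.pair_iff] at h
  exact h α β (by simpa [smul_eq_C_mul] using hab)

lemma g_not_mem (S : Finset P2C) (h8 : S.card = 8) (f f' g : Poly3)
    (hs : Submodule.span ℂ {f ^ 2, f * f', f' ^ 2, g} = Isub2C 6 (S : Set P2C)) :
    g ∉ Submodule.span ℂ {f ^ 2, f * f', f' ^ 2} := by
  intro hg
  have e : Submodule.span ℂ {f ^ 2, f * f', f' ^ 2, g} =
      Submodule.span ℂ (Set.range ![f ^ 2, f * f', f' ^ 2]) := by
    have e1 : Set.range ![f ^ 2, f * f', f' ^ 2] = {f ^ 2, f * f', f' ^ 2} := by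
      ext x; simp; tauto
    rw [e1]
    apply le_antisymm
    · rw [Submodule.span_le]
      rintro x (h | h | h | h)
      · exact Submodule.subset_span (by simp [h])
      · exact Submodule.subset_span (by simp [h])
      · exact Submodule.subset_span (by simp [h])
      · rw [h]; exact hg
    · apply Submodule.span_mono
      rintro x (h | h | h)
      · simp [h]
      · simp [h]
      · rw [h]; simp
  have h1 := dim6 S h8
  rw [← hs, e] at h1
  have h2 := finrank_range_le_card (R := ℂ) ![f ^ 2, f * f', f' ^ 2]
  simp only [Set.finrank, Fintype.card_fin] at h2
  exact absurd (h1.trans h2) (by norm_num)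

lemma quad_mem (f f' : Poly3) (a b c : ℂ) :
    C a * f ^ 2 + C b * (f * f') + C c * f' ^ 2 ∈ Submodule.span ℂ {f ^ 2, f * f', f' ^ 2} := by
  simp only [← smul_eq_C_mul]
  refine add_mem (add_mem ?_ ?_) ?_ <;>
  exact Submodule.smul_mem _ _ (Submodule.subset_span (by simp))

lemma mem_of_span {E : Submodule ℂ Poly3} {s : Set Poly3} (h : Submodule.span ℂ s = E) {x : Poly3}
    (hx : x ∈ s) : x ∈ E := h ▸ Submodule.subset_span hx

open Classical in
lemma jac_ne_zero (S : Finset P2C) (h8 : S.card = 8)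
    (hl : ∀ l : Poly3, l ≠ 0 → l.IsHomogeneous 1 →
      (S.filter fun P => eval P.rep l = 0).card ≤ 3)
    (hq : ∀ l : Poly3, l ≠ 0 → l.IsHomogeneous 2 →
      (S.filter fun P => eval P.rep l = 0).card ≤ 6)
    (f f' g : Poly3)
    (hs3 : Submodule.span ℂ {f, f'} = IsubC 3 (S : Set P2C))
    (hs6 : Submodule.span ℂ {f ^ 2, f * f', f' ^ 2, g} = Isub2C 6 (S : Set P2C)) :
    jacC f f' g ≠ 0 := by
  intro hj
  have mf : f ∈ IsubC 3 (S : Set P2C) := mem_of_span hs3 (by simp)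
  have mf' : f' ∈ IsubC 3 (S : Set P2C) := mem_of_span hs3 (by simp)
  have mg : g ∈ Isub2C 6 (S : Set P2C) := mem_of_span hs6 (by simp)
  have hf : f.IsHomogeneous 3 := mf.1
  have hf' : f'.IsHomogeneous 3 := mf'.1
  have hg : g.IsHomogeneous 6 := mg.1
  have hv : ∀ P ∈ S, eval P.rep f = 0 := mf.2
  have hv' : ∀ P ∈ S, eval P.rep f' = 0 := mf'.2
  have hgs : ∀ P ∈ S, SingAtC g P := mg.2
  have hi := findep_of_span S h8 f f' hs3
  obtain ⟨P, hP0, hPz⟩ := dependent_of_jac f f' g hj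
  obtain ⟨Q, n, hQ0, hQw, hQz⟩ := whomog_relation ![f, f', g] ![1, 1, 2] (by
    intro i; fin_cases i
    · exact hf
    · exact hf'
    · exact hg) P hP0 hPz
  obtain ⟨B, hB, hdep⟩ := dep_const f f' g Q n hQ0 hQw hQz
  obtain ⟨t, ht⟩ := ((hB.union (finite_reducible S h8 hl hq f f' hf hf' hi hv hv')).union
    (finite_singular S h8 hl hq f f' hf hf' hi hv hv')).exists_notMem
  simp only [Set.mem_union, not_or, Set.mem_ofPred_eq, not_not] at ht
  obtain ⟨⟨htB, htI⟩, htS⟩ := ht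
  push Not at htS
  have hFh : (f - C t * f').IsHomogeneous 3 := hf.sub (hf'.C_mul t)
  have hF0 : f - C t * f' ≠ 0 := htI.ne_zero
  have hnd : ¬ (f - C t * f' ∣ f') := by
    rintro ⟨k, hk⟩
    have hk0 : k.IsHomogeneous 0 := homog_of_mul (m := 3) hFh hF0 (by rw [← hk]; exact hf')
    obtain ⟨c, rfl⟩ : ∃ c, k = C c := const_of_homog_zero hk0
    have := hi c (- c * t - 1) (by
      simp only [map_sub, map_mul, map_neg, C_1]
      linear_combination -hk)
    have h2 := this.2
    rw [this.1] at h2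
    simp at h2
  obtain ⟨c, h, hh⟩ := hdep t htB htI.prime hnd
  have hh3 : h.IsHomogeneous 3 := homog_of_mul (m := 3) hFh hF0 (by
    rw [← hh]; exact hg.sub ((hf'.pow 2).C_mul c))
  have hmem : h ∈ IsubC 3 (S : Set P2C) := by
    refine ⟨hh3, ?_⟩
    intro p hp
    obtain ⟨i, hip⟩ := htS p hp
    have e := congrArg (fun q => eval p.rep (pderiv i q)) hh
    have z1 := hv p hp
    have z2 := hv' p hp
    have z3 := (hgs p hp).2 i
    simp only [Derivation.leibniz, map_sub, map_add, pow_two, smul_eq_mul, map_mul, z1, z2, z3,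
      mul_zero, zero_mul, sub_zero, add_zero, zero_add, pderiv_C] at e hip
    show eval p.rep h = 0
    have e' : eval p.rep h * (eval p.rep (pderiv i f) - eval p.rep (C t) * eval p.rep (pderiv i f')) = 0 := by
      linear_combination -e
    rcases mul_eq_zero.mp e' with h0 | h0
    · exact h0
    · exact absurd h0 hip
  rw [← hs3, Submodule.mem_span_pair] at hmem
  obtain ⟨a, b, hab⟩ := hmem
  apply g_not_mem S h8 f f' g hs6
  have : g = C a * f ^ 2 + C (b - t * a) * (f * f') + C (c - t * b) * f' ^ 2 := by
    rw [smul_eq_C_mul, smul_eq_C_mul] at hab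
    simp only [map_sub, map_mul]
    rw [← hab] at hh
    linear_combination hh
  rw [this]
  exact quad_mem f f' _ _ _

lemma jac_expand (f f' g : Poly3) : jacC f f' g =
    pderiv 0 f * pderiv 1 f' * pderiv 2 g - pderiv 0 f * pderiv 2 f' * pderiv 1 g
    - pderiv 1 f * pderiv 0 f' * pderiv 2 g + pderiv 1 f * pderiv 2 f' * pderiv 0 g
    + pderiv 2 f * pderiv 0 f' * pderiv 1 g - pderiv 2 f * pderiv 1 f' * pderiv 0 g := by
  rw [jacC, Matrix.det_fin_three]
  simp

lemma jac_homog (f f' g : Poly3) (hf : f.IsHomogeneous 3) (hf' : f'.IsHomogeneous 3)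
    (hg : g.IsHomogeneous 6) : (jacC f f' g).IsHomogeneous 9 := by
  have h : ∀ i j k, (pderiv i f * pderiv j f' * pderiv k g).IsHomogeneous 9 := by
    intro i j k
    exact ((hf.pderiv (i := i)).mul (hf'.pderiv (i := j))).mul (hg.pderiv (i := k))
  rw [jac_expand]
  exact (((((h 0 1 2).sub (h 0 2 1)).sub (h 1 0 2)).add (h 1 2 0)).add (h 2 0 1)).sub (h 2 1 0)

lemma jac_change (f f' g : Poly3) (a b c d p q r e : ℂ) :
    jacC (C a * f + C b * f') (C c * f + C d * f')
      (C p * f ^ 2 + C q * (f * f') + C r * f' ^ 2 + C e * g) =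
    C ((a * d - b * c) * e) * jacC f f' g := by
  simp only [jac_expand, Derivation.leibniz, map_sub, map_add, pow_two, smul_eq_mul, map_mul,
    pderiv_C, mul_zero, add_zero]
  ring

lemma mem_quad_span (f f' g x : Poly3)
    (h : x ∈ Submodule.span ℂ {f ^ 2, f * f', f' ^ 2, g}) :
    ∃ p q r e : ℂ, x = C p * f ^ 2 + C q * (f * f') + C r * f' ^ 2 + C e * g := by
  rw [Submodule.mem_span_insert] at h
  obtain ⟨p, y, hy, rfl⟩ := h
  rw [Submodule.mem_span_insert] at hy
  obtain ⟨q, z, hz, rfl⟩ := hy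
  rw [Submodule.mem_span_pair] at hz
  obtain ⟨r, e, rfl⟩ := hz
  refine ⟨p, q, r, e, ?_⟩
  simp only [smul_eq_C_mul]
  ring

lemma jac_ne_zero_set (T : Set P2C) (hT8 : T.encard = 8) (hgen : GenPosC T) (f f' g : Poly3)
    (hspan3 : Submodule.span ℂ {f, f'} = IsubC 3 T)
    (hspan6 : Submodule.span ℂ {f ^ 2, f * f', f' ^ 2, g} = Isub2C 6 T) :
    jacC f f' g ≠ 0 := by
  classical
  have hfin : T.Finite := Set.finite_of_encard_eq_coe (k := 8) hT8
  obtain ⟨S, rfl⟩ := hfin.exists_finset_coe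
  have h8 : S.card = 8 := by
    rw [Set.encard_coe_eq_coe_finsetCard] at hT8
    exact_mod_cast hT8
  have key : ∀ l : Poly3, {P ∈ (S : Set P2C) | VanishAtC l P} =
      ((S.filter fun P => eval P.rep l = 0 : Finset P2C) : Set P2C) := by
    intro l; ext P; simp [VanishAtC]
  refine jac_ne_zero S h8 ?_ ?_ f f' g hspan3 hspan6
  · intro l hl0 hl
    have h := hgen.1 l hl0 hl
    rw [key, Set.encard_coe_eq_coe_finsetCard] at h
    exact_mod_cast h
  · intro l hl0 hl
    have h := hgen.2 l hl0 hl
    rw [key, Set.encard_coe_eq_coe_finsetCard] at h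
    exact_mod_cast h

theorem statement16 (T : Set P2C) (hT8 : T.encard = 8) (hgen : GenPosC T)
    (f f' g : MvPolynomial (Fin 3) ℂ)
    (hspan3 : Submodule.span ℂ {f, f'} = IsubC 3 T)
    (hspan6 : Submodule.span ℂ {f ^ 2, f * f', f' ^ 2, g} = Isub2C 6 T) :
    jacC f f' g ≠ 0 ∧ (jacC f f' g).IsHomogeneous 9 ∧
    ∀ f₁ f₁' g₁ : MvPolynomial (Fin 3) ℂ,
      Submodule.span ℂ {f₁, f₁'} = IsubC 3 T →
      Submodule.span ℂ {f₁ ^ 2, f₁ * f₁', f₁' ^ 2, g₁} = Isub2C 6 T →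
      ∃ c : ℂ, c ≠ 0 ∧ jacC f₁ f₁' g₁ = C c * jacC f f' g := by
  refine ⟨jac_ne_zero_set T hT8 hgen f f' g hspan3 hspan6, jac_homog f f' g
    (mem_of_span hspan3 (by simp)).1 (mem_of_span hspan3 (by simp)).1
    (mem_of_span hspan6 (by simp)).1, ?_⟩
  intro f₁ f₁' g₁ h3 h6
  have hne := jac_ne_zero_set T hT8 hgen f₁ f₁' g₁ h3 h6
  have m1 : f₁ ∈ Submodule.span ℂ {f, f'} := by
    rw [hspan3]; exact mem_of_span h3 (by simp)
  have m2 : f₁' ∈ Submodule.span ℂ {f, f'} := by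
    rw [hspan3]; exact mem_of_span h3 (by simp)
  have m3 : g₁ ∈ Submodule.span ℂ {f ^ 2, f * f', f' ^ 2, g} := by
    rw [hspan6]; exact mem_of_span h6 (by simp)
  rw [Submodule.mem_span_pair] at m1 m2
  obtain ⟨a, b, rfl⟩ := m1
  obtain ⟨c, d, rfl⟩ := m2
  obtain ⟨p, q, r, e, rfl⟩ := mem_quad_span f f' g g₁ m3
  simp only [smul_eq_C_mul] at hne ⊢
  rw [jac_change] at hne ⊢
  refine ⟨_, ?_, rfl⟩
  intro h0
  apply hne
  rw [h0]; simp


end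
end

section
/- Let T ⊂ ℙ²(ℂ) be a set of exactly 8 points such that no 4 points of T lie on a line and no 7 points of T lie on a conic. Let f, f' be cubic forms spanning I₃(T), let g be a sextic form such that f², ff', f'², g span I₆(2T), and let j = det J(f,f',g) be the Jacobian determinant. Then every point of T is a triple point of the curve j = 0: for each P ∈ T with nonzero representative u ∈ ℂ³, j(u) = 0 and all first and second partial derivatives of j vanish at u. -/
open MvPolynomial

noncomputable section

/-- Partial derivatives commute. -/
lemma aux_comm (i j : Fin 3) (p : MvPolynomial (Fin 3) ℂ) :
    pderiv i (pderiv j p) = pderiv j (pderiv i p) := by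
  have h : ⁅(pderiv i : Derivation ℂ (MvPolynomial (Fin 3) ℂ) (MvPolynomial (Fin 3) ℂ)),
      (pderiv j : Derivation ℂ (MvPolynomial (Fin 3) ℂ) (MvPolynomial (Fin 3) ℂ))⁆ = 0 := by
    apply MvPolynomial.derivation_ext
    intro k
    rw [Derivation.commutator_apply]
    simp only [pderiv_X, Pi.single_apply]
    split_ifs <;> simp
  have h2 := congrArg (fun D : Derivation ℂ (MvPolynomial (Fin 3) ℂ) (MvPolynomial (Fin 3) ℂ) => D p) h
  simp only [Derivation.commutator_apply, Derivation.zero_apply] at h2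
  exact sub_eq_zero.mp h2

/-- Scaling of a homogeneous polynomial. -/
lemma aux_scale {n : ℕ} {p : MvPolynomial (Fin 3) ℂ} (hp : p.IsHomogeneous n)
    (c : ℂ) (v : Fin 3 → ℂ) : eval (c • v) p = c ^ n * eval v p := by
  rw [eval_eq, eval_eq, Finset.mul_sum]
  refine Finset.sum_congr rfl fun d hd => ?_
  have hdeg : ∑ i ∈ d.support, d i = n := by
    have := hp (mem_support_iff.mp hd)
    rw [Finsupp.weight_apply] at this
    simpa [Finsupp.sum] using this
  simp only [Pi.smul_apply, smul_eq_mul, mul_pow, Finset.prod_mul_distrib,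
    Finset.prod_pow_eq_pow_sum, hdeg]
  ring

lemma aux_euler {n : ℕ} {p : MvPolynomial (Fin 3) ℂ} (hp : p.IsHomogeneous n)
    {k a b : Fin 3} (hs : ∀ F : Fin 3 → MvPolynomial (Fin 3) ℂ, ∑ i, F i = F k + F a + F b) :
    X k * pderiv k p + X a * pderiv a p + X b * pderiv b p = C (n : ℂ) * p := by
  have := hp.sum_X_mul_pderiv
  rw [hs] at this
  rw [this, nsmul_eq_mul]
  simp

/-- The main local computation, in the chart where the `k`-th coordinate is nonzero. -/
lemma aux_main {f f' g J : MvPolynomial (Fin 3) ℂ} (hf : f.IsHomogeneous 3)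
    (hf' : f'.IsHomogeneous 3) (hg : g.IsHomogeneous 6) {u : Fin 3 → ℂ}
    (f0 : eval u f = 0) (f0' : eval u f' = 0) (g0 : eval u g = 0)
    (g1 : ∀ i, eval u (pderiv i g) = 0) {k a b : Fin 3} (huk : u k ≠ 0)
    (hs : ∀ F : Fin 3 → MvPolynomial (Fin 3) ℂ, ∑ i, F i = F k + F a + F b)
    (hk : ∀ i, i = k ∨ i = a ∨ i = b)
    (hJ : J = pderiv k f * (pderiv a f' * pderiv b g - pderiv b f' * pderiv a g)
      - pderiv k f' * (pderiv a f * pderiv b g - pderiv b f * pderiv a g)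
      + pderiv k g * (pderiv a f * pderiv b f' - pderiv b f * pderiv a f')) :
    eval u J = 0 ∧ (∀ i, eval u (pderiv i J) = 0) ∧
      (∀ i j, eval u (pderiv i (pderiv j J)) = 0) := by
  have ef := aux_euler hf hs
  have ef' := aux_euler hf' hs
  have eg := aux_euler hg hs
  have key : X k * J =
      C 3 * (f * (pderiv a f' * pderiv b g - pderiv b f' * pderiv a g)
      - f' * (pderiv a f * pderiv b g - pderiv b f * pderiv a g)
      + C 2 * (g * (pderiv a f * pderiv b f' - pderiv b f * pderiv a f'))) := by
    have h6 : (C ((6 : ℕ) : ℂ) : MvPolynomial (Fin 3) ℂ) = C 3 * C 2 := by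
      rw [← C_mul]; norm_num
    rw [h6] at eg
    push_cast at ef ef'
    rw [hJ]
    linear_combination (pderiv a f' * pderiv b g - pderiv b f' * pderiv a g) * ef
      - (pderiv a f * pderiv b g - pderiv b f * pderiv a g) * ef'
      + (pderiv a f * pderiv b f' - pderiv b f * pderiv a f') * eg
  have hJ0 : eval u J = 0 := by rw [hJ]; simp [g1]
  have hJ1 : ∀ i, eval u (pderiv i J) = 0 := by
    intro i
    have h := congrArg (fun p => eval u (pderiv i p)) key
    simp only [pderiv_mul, pderiv_C, map_add, map_sub, map_mul, eval_X, f0, f0', g0, g1, hJ0,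
      eval_C] at h
    have : u k * eval u (pderiv i J) = 0 := by linear_combination h
    exact (mul_eq_zero.mp this).resolve_left huk
  refine ⟨hJ0, hJ1, fun i j => ?_⟩
  have h := congrArg (fun p => eval u (pderiv i (pderiv j p))) key
  have hX : ∀ m, ∃ c : ℂ, pderiv m (X k : MvPolynomial (Fin 3) ℂ) = C c := by
    intro m
    by_cases hm : k = m
    · exact ⟨1, by rw [hm]; simp⟩
    · exact ⟨0, by rw [pderiv_X_of_ne hm]; simp⟩
  obtain ⟨ci, hci⟩ := hX i
  obtain ⟨cj, hcj⟩ := hX j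
  simp only [pderiv_mul, pderiv_C, map_add, map_sub, map_mul, eval_X, f0, f0', g0, g1, hJ0, hJ1,
    hci, hcj, eval_C, map_zero] at h
  have sf := congrArg (eval u) ef
  have sf' := congrArg (eval u) ef'
  have sg : ∀ m, u k * eval u (pderiv k (pderiv m g)) + u a * eval u (pderiv a (pderiv m g))
      + u b * eval u (pderiv b (pderiv m g)) = 0 := by
    intro m
    have := congrArg (eval u) (aux_euler (hg.pderiv (i := m)) hs)
    simpa [g1] using this
  have cab := aux_comm a b g
  have cak := aux_comm a k g
  have cbk := aux_comm b k g
  have sga := sg a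
  have sgb := sg b
  have sgk := sg k
  simp only [map_add, map_mul, eval_X, f0, f0', mul_zero] at sf sf'
  rw [cab] at sgb
  rw [cak, cbk] at sgk
  obtain ⟨p, hp⟩ : ∃ p, u a = - p * u k := ⟨-(u a / u k), by field_simp⟩
  obtain ⟨q, hq⟩ : ∃ q, u b = - q * u k := ⟨-(u b / u k), by field_simp⟩
  have solve : ∀ x y z : ℂ, u k * x + u a * y + u b * z = 0 → x = p * y + q * z := by
    intro x y z hxyz
    rw [hp, hq] at hxyz
    apply mul_left_cancel₀ huk
    linear_combination hxyz
  have tf := solve _ _ _ sf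
  have tf' := solve _ _ _ sf'
  have tga := solve _ _ _ sga
  have tgb := solve _ _ _ sgb
  have tgk := solve _ _ _ sgk
  have : u k * eval u (pderiv i (pderiv j J)) = 0 := by
    rcases hk i with rfl | rfl | rfl <;> rcases hk j with rfl | rfl | rfl <;>
    (try simp only [cab, cak, cbk, tf, tf', tgk, tga, tgb] at h) <;> linear_combination h
  exact (mul_eq_zero.mp this).resolve_left huk

theorem statement17 (T : Set P2C) (hT8 : T.encard = 8) (hgen : GenPosC T)
    (f f' g : MvPolynomial (Fin 3) ℂ)
    (hspan3 : Submodule.span ℂ {f, f'} = IsubC 3 T)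
    (hspan6 : Submodule.span ℂ {f ^ 2, f * f', f' ^ 2, g} = Isub2C 6 T) :
    ∀ P ∈ T, ∀ (u : Fin 3 → ℂ) (hu : u ≠ 0), Projectivization.mk ℂ u hu = P →
      eval u (jacC f f' g) = 0 ∧
      (∀ i, eval u (pderiv i (jacC f f' g)) = 0) ∧
      (∀ i j, eval u (pderiv i (pderiv j (jacC f f' g))) = 0) := by
  intro P hP u hu hPu
  have hf : f ∈ IsubC 3 T := hspan3 ▸ Submodule.subset_span (by simp)
  have hf' : f' ∈ IsubC 3 T := hspan3 ▸ Submodule.subset_span (by simp)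
  have hg : g ∈ Isub2C 6 T := hspan6 ▸ Submodule.subset_span (by simp)
  obtain ⟨c, hc⟩ := Projectivization.exists_smul_eq_mk_rep ℂ u hu
  rw [hPu] at hc
  have hfh : f.IsHomogeneous 3 := hf.1
  have hfh' : f'.IsHomogeneous 3 := hf'.1
  have hgh : g.IsHomogeneous 6 := hg.1
  have vanish : ∀ {n : ℕ} {p : MvPolynomial (Fin 3) ℂ}, p.IsHomogeneous n →
      eval P.rep p = 0 → eval u p = 0 := by
    intro n p hp h0
    rw [← hc, show c • u = (c : ℂ) • u from rfl, aux_scale hp] at h0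
    exact (mul_eq_zero.mp h0).resolve_left (pow_ne_zero _ c.ne_zero)
  have f0 := vanish hfh (hf.2 P hP)
  have f0' := vanish hfh' (hf'.2 P hP)
  have g0 := vanish hgh (hg.2 P hP).1
  have g1 : ∀ i, eval u (pderiv i g) = 0 := fun i =>
    vanish (hgh.pderiv (i := i)) ((hg.2 P hP).2 i)
  obtain ⟨k, huk⟩ := Function.ne_iff.mp hu
  have huk : u k ≠ 0 := huk
  have hdet : jacC f f' g = pderiv 0 f * (pderiv 1 f' * pderiv 2 g - pderiv 2 f' * pderiv 1 g)
      - pderiv 0 f' * (pderiv 1 f * pderiv 2 g - pderiv 2 f * pderiv 1 g)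
      + pderiv 0 g * (pderiv 1 f * pderiv 2 f' - pderiv 2 f * pderiv 1 f') := by
    simp [jacC, Matrix.det_fin_three]
    ring
  fin_cases k
  · exact aux_main hfh hfh' hgh f0 f0' g0 g1 (k := 0) (a := 1) (b := 2) huk
      (fun F => Fin.sum_univ_three F) (by decide) hdet
  · exact aux_main hfh hfh' hgh f0 f0' g0 g1 (k := 1) (a := 2) (b := 0) huk
      (fun F => by rw [Fin.sum_univ_three]; ring) (by decide) (by rw [hdet]; ring)
  · exact aux_main hfh hfh' hgh f0 f0' g0 g1 (k := 2) (a := 0) (b := 1) huk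
      (fun F => by rw [Fin.sum_univ_three]; ring) (by decide) (by rw [hdet]; ring)

end
end
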